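/- For every integer k ≥ 2 there exists an Eulerian plane triangulation of order n = 24k whose connected domination number is exactly 3n/8 − 1 = 9k − 1. -/

import Mathlib

/-- A drawing (embedding) of a simple graph in the plane `ℝ × ℝ` without crossings:
vertices are mapped to distinct points, each edge to an injective arc joining its
endpoints, arcs pass through no other vertex, and two arcs of distinct edges meet
only in common endpoints. -/
structure PlaneEmbedding {V : Type} (G : SimpleGraph V) where
  vtx : V → ℝ × ℝ
  vtx_inj : Function.Injective vtx
  arc : ∀ ⦃u v : V⦄, G.Adj u v → Set (ℝ × ℝ)
  arc_symm : ∀ ⦃u v : V⦄ (h : G.Adj u v), arc h.symm = arc h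
  arc_path : ∀ ⦃u v : V⦄ (h : G.Adj u v),
    ∃ γ : Path (vtx u) (vtx v), Function.Injective ⇑γ ∧ Set.range ⇑γ = arc h
  arc_vtx : ∀ ⦃u v : V⦄ (h : G.Adj u v) (w : V), vtx w ∈ arc h → w = u ∨ w = v
  arc_inter : ∀ ⦃u v a b : V⦄ (h₁ : G.Adj u v) (h₂ : G.Adj a b), s(u, v) ≠ s(a, b) →
    arc h₁ ∩ arc h₂ ⊆ ({vtx u, vtx v} : Set (ℝ × ℝ)) ∩ {vtx a, vtx b}

namespace PlaneEmbedding

variable {V : Type} {G : SimpleGraph V}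

/-- The point set of the sub-drawing determined by the vertices in `S`
(the inherited embedding of the induced subgraph on `S`). -/
def subSupport (E : PlaneEmbedding G) (S : Set V) : Set (ℝ × ℝ) :=
  E.vtx '' S ∪ ⋃ (u : V) (_ : u ∈ S) (v : V) (_ : v ∈ S) (h : G.Adj u v), E.arc h

/-- The induced subgraph on `S`, with the inherited embedding, is an outerplane graph:
every vertex of `S` lies on the boundary of the outer (unbounded) face, i.e. in the
closure of the set of points belonging to unbounded faces of the sub-drawing. -/
def OuterplaneOn (E : PlaneEmbedding G) (S : Set V) : Prop :=
  ∀ v ∈ S, E.vtx v ∈ closure {p | p ∉ E.subSupport S ∧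
    ¬ Bornology.IsBounded (connectedComponentIn (E.subSupport S)ᶜ p)}

/-- The whole drawing is an outerplane graph. -/
def IsOuterplane (E : PlaneEmbedding G) : Prop := E.OuterplaneOn Set.univ

end PlaneEmbedding

/-- A graph is planar if it admits a plane embedding. -/
def IsPlanar {V : Type} (G : SimpleGraph V) : Prop := Nonempty (PlaneEmbedding G)

/-- A graph is outerplanar if it admits a plane embedding with all vertices on the
boundary of the outer face. -/
def IsOuterplanar {V : Type} (G : SimpleGraph V) : Prop :=
  ∃ E : PlaneEmbedding G, E.IsOuterplane

/-- A plane triangulation is an edge-maximal (finite) planar graph. -/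
def IsPlaneTriangulation {V : Type} (G : SimpleGraph V) : Prop :=
  IsPlanar G ∧ ∀ u v : V, u ≠ v → ¬ G.Adj u v →
    ¬ IsPlanar (G ⊔ SimpleGraph.fromEdgeSet {s(u, v)})

/-- `G` has a `K_m`-minor: there are `m` pairwise disjoint nonempty connected branch
sets with an edge between any two of them. -/
def HasCliqueMinor {V : Type} (G : SimpleGraph V) (m : ℕ) : Prop :=
  ∃ B : Fin m → Set V,
    (∀ i, (B i).Nonempty) ∧
    (∀ i, (G.induce (B i)).Connected) ∧
    (∀ i j, i ≠ j → Disjoint (B i) (B j)) ∧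
    (∀ i j, i ≠ j → ∃ u ∈ B i, ∃ v ∈ B j, G.Adj u v)

/-- `G` is `K₄`-minor free. -/
def K4MinorFree {V : Type} (G : SimpleGraph V) : Prop := ¬ HasCliqueMinor G 4

/-- `s_{o'}(G)` for a fixed plane embedding of `G`: the maximum order of an induced
subgraph whose inherited embedding is an outerplane graph. -/
noncomputable def sO' {V : Type} [Fintype V] {G : SimpleGraph V}
    (E : PlaneEmbedding G) : ℕ :=
  sSup {n | ∃ S : Finset V, E.OuterplaneOn ↑S ∧ S.card = n}

/-- `s_o(G)`: the maximum order of an induced outerplanar subgraph of `G`. -/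
noncomputable def sO {V : Type} [Fintype V] (G : SimpleGraph V) : ℕ :=
  sSup {n | ∃ S : Finset V, IsOuterplanar (G.induce (↑S : Set V)) ∧ S.card = n}

/-- `s_{K₄}(G)`: the maximum order of an induced `K₄`-minor-free subgraph of `G`. -/
noncomputable def sK4 {V : Type} [Fintype V] (G : SimpleGraph V) : ℕ :=
  sSup {n | ∃ S : Finset V, K4MinorFree (G.induce (↑S : Set V)) ∧ S.card = n}

/-- `tw(G) ≤ k`: `G` admits a tree decomposition of width at most `k`. -/
def TreewidthLE {V : Type} (G : SimpleGraph V) (k : ℕ) : Prop :=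
  ∃ (ι : Type) (T : SimpleGraph ι) (bag : ι → Set V),
    T.IsTree ∧
    (∀ v : V, ∃ i, v ∈ bag i) ∧
    (∀ u v : V, G.Adj u v → ∃ i, u ∈ bag i ∧ v ∈ bag i) ∧
    (∀ v : V, (T.induce {i | v ∈ bag i}).Connected) ∧
    (∀ i, (bag i).ncard ≤ k + 1)

/-- `G` is a `k`-tree: its vertices admit a construction order in which the first
`k+1` vertices form a complete graph and every later vertex is joined to exactly
`k` earlier, pairwise adjacent, vertices. -/
def IsKTree (k : ℕ) {V : Type} (G : SimpleGraph V) : Prop :=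
  ∃ (n : ℕ) (e : Fin n ≃ V), k + 1 ≤ n ∧
    (∀ i j : Fin n, (i : ℕ) < k + 1 → (j : ℕ) < k + 1 → i ≠ j → G.Adj (e i) (e j)) ∧
    (∀ j : Fin n, k + 1 ≤ (j : ℕ) →
      {i : Fin n | i < j ∧ G.Adj (e i) (e j)}.ncard = k ∧
      (∀ i i' : Fin n, i < j → i' < j → G.Adj (e i) (e j) → G.Adj (e i') (e j) →
        i ≠ i' → G.Adj (e i) (e i')))

/-- `S` is a dominating set of `G`. -/
def IsDomSet {V : Type} (G : SimpleGraph V) (S : Set V) : Prop :=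
  ∀ v : V, v ∈ S ∨ ∃ u ∈ S, G.Adj u v

/-- `S` is a connected dominating set of `G`. -/
def IsConnDomSet {V : Type} (G : SimpleGraph V) (S : Set V) : Prop :=
  IsDomSet G S ∧ (G.induce S).Connected

/-- The domination number `γ(G)`. -/
noncomputable def domNum {V : Type} [Fintype V] (G : SimpleGraph V) : ℕ :=
  sInf {n | ∃ S : Finset V, IsDomSet G ↑S ∧ S.card = n}

/-- The connected domination number `γ_c(G)`. -/
noncomputable def connDomNum {V : Type} [Fintype V] (G : SimpleGraph V) : ℕ :=
  sInf {n | ∃ S : Finset V, IsConnDomSet G ↑S ∧ S.card = n}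

/-- A graph is Eulerian if every vertex has even degree. -/
def IsEulerian {V : Type} (G : SimpleGraph V) : Prop :=
  ∀ v : V, Even (G.neighborSet v).ncard

/-- `G` contains a subgraph isomorphic to `H`. -/
def ContainsCopy {W V : Type} (H : SimpleGraph W) (G : SimpleGraph V) : Prop :=
  ∃ f : H →g G, Function.Injective ⇑f

/-- The complete tripartite graph `K_{1,1,3}`. -/
def K113 : SimpleGraph (Fin 5) :=
  SimpleGraph.fromEdgeSet {s(0, 1), s(0, 2), s(0, 3), s(0, 4), s(1, 2), s(1, 3), s(1, 4)}

/-- `G` is a maximal outerplanar graph. -/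
def IsMaximalOuterplanar {V : Type} (G : SimpleGraph V) : Prop :=
  IsOuterplanar G ∧ ∀ u v : V, u ≠ v → ¬ G.Adj u v →
    ¬ IsOuterplanar (G ⊔ SimpleGraph.fromEdgeSet {s(u, v)})

/-! ### Nonplanarity of `K₅` -/

/-- A nowhere vanishing continuous function on a simply connected space has a continuous
logarithm. -/
theorem exists_continuous_log {A : Type*} [TopologicalSpace A] [SimplyConnectedSpace A]
    [LocallyPathConnectedSpace A] (f : C(A, ℂ)) (hf : ∀ a, f a ≠ 0) :
    ∃ L : C(A, ℂ), ∀ a, Complex.exp (L a) = f a := by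
  obtain ⟨a₀⟩ : Nonempty A := inferInstance
  obtain ⟨L, ⟨-, hL⟩, -⟩ := Complex.isCoveringMapOn_exp.existsUnique_continuousMap_lifts f
    (a₀ := a₀) (e₀ := Complex.log (f a₀)) (Complex.exp_log (hf a₀)) (by simpa using hf)
  exact ⟨L, fun a => congrFun hL a⟩

/-- Two continuous logarithms of the same function along a curve have the same increment. -/
theorem log_increment_unique {L L' : C(ℝ, ℂ)} (h : ∀ t, Complex.exp (L t) = Complex.exp (L' t)) :
    L 1 - L 0 = L' 1 - L' 0 := by
  obtain ⟨F, -, hF⟩ := Complex.isCoveringMapOn_exp.existsUnique_continuousMap_lifts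
    (⟨fun t => Complex.exp (L t), by fun_prop⟩ : C(ℝ, ℂ)) (a₀ := 0) (e₀ := L 0) rfl (by simp)
  have h₁ := hF L ⟨rfl, rfl⟩
  have h₂ := hF (⟨fun t => L' t + (L 0 - L' 0), by fun_prop⟩ : C(ℝ, ℂ)) ⟨by simp, by
    ext t
    simp [Complex.exp_add, Complex.exp_sub, h]⟩
  have h₃ : L 1 = L' 1 + (L 0 - L' 0) := DFunLike.congr_fun (h₁.trans h₂.symm) 1
  rw [h₃]
  ring

open Classical in
/-- The increment over `[0, 1]` of a continuous logarithm of `f - c`. -/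
noncomputable def logIncrement (f : C(ℝ, ℂ)) (c : ℂ) : ℂ :=
  if h : ∃ L : C(ℝ, ℂ), ∀ t, Complex.exp (L t) = f t - c then h.choose 1 - h.choose 0 else 0

theorem logIncrement_eq {f : C(ℝ, ℂ)} {c : ℂ} (L : C(ℝ, ℂ))
    (hL : ∀ t, Complex.exp (L t) = f t - c) : logIncrement f c = L 1 - L 0 := by
  have h : ∃ L : C(ℝ, ℂ), ∀ t, Complex.exp (L t) = f t - c := ⟨L, hL⟩
  rw [logIncrement, dif_pos h]
  exact log_increment_unique fun t => by rw [h.choose_spec t, hL t]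

theorem exp_logIncrement {f : C(ℝ, ℂ)} {c : ℂ} (hc : ∀ t, f t ≠ c) :
    Complex.exp (logIncrement f c) = (f 1 - c) / (f 0 - c) := by
  obtain ⟨L, hL⟩ := exists_continuous_log (f - .const ℝ c) fun t => sub_ne_zero.2 (hc t)
  rw [logIncrement_eq L hL, Complex.exp_sub, hL, hL]
  rfl

/-- For disjoint curves `f` and `g`, the two ways of moving from `(f 0, g 0)` to `(f 1, g 1)` by
traversing one curve after the other turn the connecting vector by the same amount. -/
theorem logIncrement_square {f g : C(ℝ, ℂ)} (h : ∀ s t, f s ≠ g t) :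
    logIncrement f (g 0) + logIncrement g (f 1) = logIncrement g (f 0) + logIncrement f (g 1) := by
  obtain ⟨L, hL⟩ := exists_continuous_log
    (⟨fun z => g z.2 - f z.1, by fun_prop⟩ : C(ℝ × ℝ, ℂ)) fun z => sub_ne_zero.2 (h _ _).symm
  have hg (s : ℝ) : logIncrement g (f s) = L (s, 1) - L (s, 0) :=
    logIncrement_eq (⟨fun t => L (s, t), by fun_prop⟩ : C(ℝ, ℂ)) fun t => hL (s, t)
  have hf (t : ℝ) : logIncrement f (g t) = L (1, t) - L (0, t) := by
    rw [logIncrement_eq (⟨fun s => L (s, t) + Real.pi * Complex.I, by fun_prop⟩ : C(ℝ, ℂ))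
      fun s => ?_]
    · simp
    · have := hL (s, t)
      simp_all [Complex.exp_add]
  rw [hf, hf, hg, hg]
  ring

/-- There are no five points in the plane that are pairwise joined by curves such that curves
without common endpoints are disjoint. -/
theorem no_K5_drawing (p : Fin 5 → ℂ) (f : Fin 5 → Fin 5 → C(ℝ, ℂ))
    (h₀ : ∀ a b, a < b → f a b 0 = p a) (h₁ : ∀ a b, a < b → f a b 1 = p b)
    (hf : ∀ a b c d, a < b → c < d → a ≠ c → a ≠ d → b ≠ c → b ≠ d →
      ∀ s t, f a b s ≠ f c d t) : False := by
  have avoid (c a b : Fin 5) (hab : a < b) (hca : c ≠ a) (hcb : c ≠ b) (t : ℝ) :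
      f a b t ≠ p c := by
    obtain ⟨d, hda, hdb, hdc⟩ : ∃ d : Fin 5, d ≠ a ∧ d ≠ b ∧ d ≠ c := by
      revert a b c; decide
    rcases lt_or_gt_of_ne hdc with h | h
    · rw [← h₁ d c h]
      exact hf a b d c hab h hda.symm hca.symm hdb.symm hcb.symm t 1
    · rw [← h₀ c d h]
      exact hf a b c d hab h hca.symm hda.symm hcb.symm hdb.symm t 0
  have p_ne (a b : Fin 5) (hab : a ≠ b) : p a ≠ p b := by
    obtain ⟨d, hda, hdb⟩ : ∃ d : Fin 5, d ≠ a ∧ d ≠ b := by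
      revert a b; decide
    rcases lt_or_gt_of_ne hda with h | h
    · rw [← h₁ d a h]
      exact avoid b d a h hdb.symm hab.symm 1
    · rw [← h₀ a d h]
      exact avoid b a d h hab.symm hdb.symm 0
  let ℓ (a b : Fin 5) : ℂ := if a < b then Complex.log (p b - p a)
    else Complex.log (p a - p b) + Real.pi * Complex.I
  have exp_ℓ (a b : Fin 5) (hab : a ≠ b) : Complex.exp (ℓ a b) = p b - p a := by
    by_cases h : a < b
    · simp only [ℓ, if_pos h]
      exact Complex.exp_log (sub_ne_zero.2 (p_ne _ _ hab.symm))
    · simp only [ℓ, if_neg h, Complex.exp_add, Complex.exp_pi_mul_I]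
      rw [Complex.exp_log (sub_ne_zero.2 (p_ne _ _ hab))]
      ring
  have exists_int (c a b : Fin 5) : ∃ n : ℤ, a < b → c ≠ a → c ≠ b →
      logIncrement (f a b) (p c) = ℓ c b - ℓ c a + n * (2 * Real.pi * Complex.I) := by
    by_cases h : a < b ∧ c ≠ a ∧ c ≠ b
    · obtain ⟨hab, hca, hcb⟩ := h
      obtain ⟨n, hn⟩ := Complex.exp_eq_exp_iff_exists_int.1
        (show Complex.exp (logIncrement (f a b) (p c)) = Complex.exp (ℓ c b - ℓ c a) by
          rw [exp_logIncrement (avoid c a b hab hca hcb), Complex.exp_sub, exp_ℓ c b hcb,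
            exp_ℓ c a hca, h₀ a b hab, h₁ a b hab])
      exact ⟨n, fun _ _ _ => hn⟩
    · exact ⟨0, fun h₁ h₂ h₃ => absurd ⟨h₁, h₂, h₃⟩ h⟩
  choose n hn using exists_int
  let σ (a b : Fin 5) : ℤ := if a < b then -1 else 1
  have hσ (a b : Fin 5) (hab : a ≠ b) : ℓ a b - ℓ b a = σ a b * (Real.pi * Complex.I) := by
    rcases lt_or_gt_of_ne hab with h | h
    · simp [ℓ, σ, h, h.not_gt]
    · simp [ℓ, σ, h, h.not_gt]
  have key (a b c d : Fin 5) (hab : a < b) (hcd : c < d) (hac : a ≠ c) (had : a ≠ d)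
      (hbc : b ≠ c) (hbd : b ≠ d) :
      2 * (n c a b + n b c d - n a c d - n d a b) + (σ c b - σ c a + σ b d - σ a d) = 0 := by
    have hs := logIncrement_square (hf a b c d hab hcd hac had hbc hbd)
    rw [h₀ a b hab, h₁ a b hab, h₀ c d hcd, h₁ c d hcd, hn c a b hab hac.symm hbc.symm,
      hn b c d hcd hbc hbd, hn a c d hcd hac had, hn d a b hab had.symm hbd.symm] at hs
    have e : ((2 * (n c a b + n b c d - n a c d - n d a b) + (σ c b - σ c a + σ b d - σ a d) : ℤ)
        : ℂ) * (Real.pi * Complex.I) = 0 := by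
      push_cast
      linear_combination hs - hσ c b hbc.symm + hσ c a hac.symm - hσ b d hbd + hσ a d had
    have hπ : (Real.pi * Complex.I : ℂ) ≠ 0 := by simp [Real.pi_ne_zero]
    exact_mod_cast (mul_eq_zero.1 e).resolve_right hπ
  have k₀₁₂₃ := key 0 1 2 3
  have k₀₁₂₄ := key 0 1 2 4
  have k₀₁₃₄ := key 0 1 3 4
  have k₀₂₁₃ := key 0 2 1 3
  have k₀₂₁₄ := key 0 2 1 4
  have k₀₂₃₄ := key 0 2 3 4
  have k₀₃₁₂ := key 0 3 1 2
  have k₀₃₁₄ := key 0 3 1 4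
  have k₀₃₂₄ := key 0 3 2 4
  have k₀₄₁₂ := key 0 4 1 2
  have k₀₄₁₃ := key 0 4 1 3
  have k₀₄₂₃ := key 0 4 2 3
  have k₁₂₃₄ := key 1 2 3 4
  have k₁₃₂₄ := key 1 3 2 4
  have k₁₄₂₃ := key 1 4 2 3
  simp +decide [σ] at *
  omega

namespace PlaneEmbedding

variable {V : Type} {G : SimpleGraph V} (E : PlaneEmbedding G)

theorem vtx_mem_subSupport {S : Set V} {v : V} (hv : v ∈ S) : E.vtx v ∈ E.subSupport S :=
  Or.inl ⟨v, hv, rfl⟩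

theorem arc_subset_subSupport {S : Set V} {u v : V} (hu : u ∈ S) (hv : v ∈ S) (h : G.Adj u v) :
    E.arc h ⊆ E.subSupport S := by
  intro x hx
  refine Or.inr ?_
  simp only [Set.mem_iUnion]
  exact ⟨u, hu, v, hv, h, hx⟩

theorem mem_subSupport {S : Set V} {x : ℝ × ℝ} : x ∈ E.subSupport S ↔
    (∃ v ∈ S, E.vtx v = x) ∨ ∃ u ∈ S, ∃ v ∈ S, ∃ h : G.Adj u v, x ∈ E.arc h := by
  simp [subSupport]

theorem subSupport_mono {S T : Set V} (hST : S ⊆ T) : E.subSupport S ⊆ E.subSupport T := by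
  intro x hx
  rw [mem_subSupport] at hx ⊢
  rcases hx with ⟨v, hv, h⟩ | ⟨u, hu, v, hv, h⟩
  · exact Or.inl ⟨v, hST hv, h⟩
  · exact Or.inr ⟨u, hST hu, v, hST hv, h⟩

theorem disjoint_subSupport {S T : Set V} (hST : Disjoint S T) :
    Disjoint (E.subSupport S) (E.subSupport T) := by
  rw [Set.disjoint_left] at hST ⊢
  intro x hS hT
  rw [mem_subSupport] at hS hT
  rcases hS with ⟨v, hv, rfl⟩ | ⟨u, hu, v, hv, h, hx⟩ <;>
    rcases hT with ⟨v', hv', h'⟩ | ⟨u', hu', v', hv', h', hx'⟩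
  · exact hST hv (E.vtx_inj h' ▸ hv')
  · rcases E.arc_vtx h' v hx' with rfl | rfl
    · exact hST hv hu'
    · exact hST hv hv'
  · subst h'
    rcases E.arc_vtx h v' hx with rfl | rfl
    · exact hST hu hv'
    · exact hST hv hv'
  · have hne : s(u, v) ≠ s(u', v') := by
      intro he
      rcases Sym2.eq_iff.1 he with ⟨rfl, -⟩ | ⟨rfl, -⟩
      · exact hST hu hu'
      · exact hST hu hv'
    obtain ⟨rfl | rfl, h₂⟩ := E.arc_inter h h' hne ⟨hx, hx'⟩
    · rcases E.arc_vtx h' u hx' with rfl | rfl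
      · exact hST hu hu'
      · exact hST hu hv'
    · rcases E.arc_vtx h' v hx' with rfl | rfl
      · exact hST hv hu'
      · exact hST hv hv'

theorem joinedIn_of_adj {S : Set V} {u v : V} (hu : u ∈ S) (hv : v ∈ S) (h : G.Adj u v) :
    JoinedIn (E.subSupport S) (E.vtx u) (E.vtx v) := by
  obtain ⟨γ, -, hγ⟩ := E.arc_path h
  exact ⟨γ, fun t => E.arc_subset_subSupport hu hv h (hγ ▸ Set.mem_range_self t)⟩

theorem joinedIn_of_reachable {S : Set V} {u v : S} (h : (G.induce S).Reachable u v) :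
    JoinedIn (E.subSupport S) (E.vtx u) (E.vtx v) := by
  obtain ⟨p⟩ := h
  induction p with
  | @nil u => exact JoinedIn.refl (E.vtx_mem_subSupport u.2)
  | @cons u v w h p ih => exact (E.joinedIn_of_adj u.2 v.2 h).trans ih

/-- Graphs with a plane embedding have no `K₅`-minor. -/
theorem not_hasCliqueMinor_five (E : PlaneEmbedding G) : ¬ HasCliqueMinor G 5 := by
  rintro ⟨B, hne, hconn, hdisj, hadj⟩
  choose b hb using hne
  have joined (i j : Fin 5) (hij : i < j) :
      JoinedIn (E.subSupport (B i ∪ B j)) (E.vtx (b i)) (E.vtx (b j)) := by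
    obtain ⟨u, hu, v, hv, h⟩ := hadj i j hij.ne
    have h₁ := E.joinedIn_of_reachable ((hconn i).preconnected ⟨b i, hb i⟩ ⟨u, hu⟩)
    have h₂ := E.joinedIn_of_reachable ((hconn j).preconnected ⟨v, hv⟩ ⟨b j, hb j⟩)
    exact (h₁.mono (E.subSupport_mono Set.subset_union_left)).trans
      ((E.joinedIn_of_adj (Or.inl hu) (Or.inr hv) h).trans
        (h₂.mono (E.subSupport_mono Set.subset_union_right)))
  have curve (i j : Fin 5) : ∃ f : C(ℝ, ℝ × ℝ), i < j → f 0 = E.vtx (b i) ∧ f 1 = E.vtx (b j) ∧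
      ∀ t, f t ∈ E.subSupport (B i ∪ B j) := by
    by_cases hij : i < j
    · obtain ⟨γ, hγ⟩ := joined i j hij
      refine ⟨⟨γ.extend, γ.continuous_extend⟩, fun _ => ⟨γ.extend_zero, γ.extend_one, fun t => ?_⟩⟩
      exact hγ _
    · exact ⟨.const _ 0, fun h => absurd h hij⟩
  choose f hf using curve
  let e := Complex.equivRealProdCLM.symm
  refine no_K5_drawing (fun i => e (E.vtx (b i)))
    (fun i j => ⟨fun t => e (f i j t), by fun_prop⟩) ?_ ?_ ?_
  · intro i j hij
    exact congrArg e (hf i j hij).1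
  · intro i j hij
    exact congrArg e (hf i j hij).2.1
  · intro i j k l hij hkl hik hil hjk hjl s t hst
    have hst' : f i j s = f k l t := e.injective hst
    refine Set.disjoint_left.1 (E.disjoint_subSupport ?_) ((hf i j hij).2.2 s)
      (hst' ▸ (hf k l hkl).2.2 t)
    simp [hdisj, hik, hil, hjk, hjl]

end PlaneEmbedding

/-! ### Cliques and clique minors -/

theorem connected_induce_of_isClique {V : Type*} {G : SimpleGraph V} {S : Set V}
    (hS : G.IsClique S) (hne : S.Nonempty) : (G.induce S).Connected := by
  have : Nonempty S := hne.to_subtype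
  refine ⟨fun x y => ?_⟩
  by_cases h : x = y
  · rw [h]
  · exact SimpleGraph.Adj.reachable (hS x.2 y.2 fun e => h (Subtype.ext e))

/-- A triangle `t` together with two adjacent connected sets that are both adjacent to all vertices
of `t` forms a `K₅`-minor. -/
theorem hasCliqueMinor_five_of_triangle {V : Type} {G : SimpleGraph V} (t : Fin 3 → V)
    {L M : Set V} (ht : ∀ c d, c ≠ d → G.Adj (t c) (t d)) (hL : (G.induce L).Connected)
    (hM : (G.induce M).Connected) (hLM : Disjoint L M) (htL : ∀ c, t c ∉ L) (htM : ∀ c, t c ∉ M)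
    (hLt : ∀ c, ∃ x ∈ L, G.Adj (t c) x) (hMt : ∀ c, ∃ x ∈ M, G.Adj (t c) x)
    (hadj : ∃ x ∈ L, ∃ y ∈ M, G.Adj x y) : HasCliqueMinor G 5 := by
  have hsingle (c : Fin 3) : (G.induce {t c}).Connected :=
    connected_induce_of_isClique (SimpleGraph.isClique_singleton _) (Set.singleton_nonempty _)
  have hLt' (c : Fin 3) : ∃ x ∈ L, G.Adj x (t c) := by simpa [G.adj_comm] using hLt c
  have hMt' (c : Fin 3) : ∃ x ∈ M, G.Adj x (t c) := by simpa [G.adj_comm] using hMt c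
  have hadj' : ∃ y ∈ M, ∃ x ∈ L, G.Adj y x := by
    obtain ⟨x, hx, y, hy, h⟩ := hadj
    exact ⟨y, hy, x, hx, h.symm⟩
  have hLne : L.Nonempty := Set.nonempty_coe_sort.1 hL.nonempty
  have hMne : M.Nonempty := Set.nonempty_coe_sort.1 hM.nonempty
  have hne (c d : Fin 3) (h : c ≠ d) : t c ≠ t d := (ht c d h).ne
  refine ⟨![{t 0}, {t 1}, {t 2}, L, M], ?_, ?_, ?_, ?_⟩
  · simp [Fin.forall_fin_succ, hLne, hMne]
  · have := hsingle 0
    have := hsingle 1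
    have := hsingle 2
    intro i
    fin_cases i <;> assumption
  · intro i j hij
    fin_cases i <;> fin_cases j <;> first | exact absurd rfl hij | simp_all [hLM.symm]
  · intro i j hij
    fin_cases i <;> fin_cases j <;> first | exact absurd rfl hij | simp_all

/-! ### Iterated octahedron insertions -/

/-- The data of an iterated insertion of triangles into triangular faces. Triangle `i` has vertices
`(i, c)` for the colors `c : Fin 3`; for `0 < i` it is inserted into the face with corners
`(corner i c, c)`. This face is either the inside of triangle `par i`, or, if `kind i = some c`,
the face spanned by the edge of triangle `par i` opposite to color `c` and the corner of color `c`
of the face into which triangle `par i` was inserted. -/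
structure InsertionTree where
  par : ℕ → ℕ
  kind : ℕ → Option (Fin 3)
  corner : ℕ → Fin 3 → ℕ
  par_lt : ∀ i, 0 < i → par i < i
  corner_zero : ∀ c, corner 0 c = 0
  corner_eq : ∀ i c, 0 < i → corner i c = if kind i = some c then corner (par i) c else par i
  par_pos : ∀ i c, 0 < i → kind i = some c → 0 < par i
  kind_inj : ∀ i j, 0 < i → 0 < j → par i = par j → kind i = kind j → i = j

namespace InsertionTree

variable (T : InsertionTree)

theorem corner_le (i : ℕ) (c : Fin 3) : T.corner i c ≤ i := by
  induction i using Nat.strong_induction_on with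
  | _ i ih =>
    rcases Nat.eq_zero_or_pos i with rfl | hi
    · exact (T.corner_zero c).le
    · have h₁ := T.par_lt i hi
      have h₂ := ih _ h₁
      rw [T.corner_eq i c hi]
      split_ifs <;> omega

theorem corner_le_par {i : ℕ} (hi : 0 < i) (c : Fin 3) : T.corner i c ≤ T.par i := by
  have := T.corner_le (T.par i) c
  rw [T.corner_eq i c hi]
  split_ifs <;> omega

theorem corner_lt {i : ℕ} (hi : 0 < i) (c : Fin 3) : T.corner i c < i :=
  (T.corner_le_par hi c).trans_lt (T.par_lt i hi)

theorem corner_eq_par_iff {i : ℕ} (hi : 0 < i) (c : Fin 3) :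
    T.corner i c = T.par i ↔ T.kind i ≠ some c := by
  rw [T.corner_eq i c hi]
  split_ifs with h
  · simpa [h] using (T.corner_lt (T.par_pos i c hi h) c).ne
  · simpa using h

theorem corner_injective {i j : ℕ} (hi : 0 < i) (hj : 0 < j)
    (h : ∀ c, T.corner i c = T.corner j c) : i = j := by
  have hmax {i : ℕ} (hi : 0 < i) : ∃ c, T.corner i c = T.par i := by
    simp only [T.corner_eq_par_iff hi]
    rcases T.kind i with - | d
    · exact ⟨0, by simp⟩
    · exact ⟨d + 1, by revert d; decide⟩
  have hpar : T.par i = T.par j := by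
    obtain ⟨c, hc⟩ := hmax hi
    obtain ⟨d, hd⟩ := hmax hj
    have := T.corner_le_par hi d
    have := T.corner_le_par hj c
    have := h c
    have := h d
    omega
  refine T.kind_inj i j hi hj hpar (Option.ext fun c => ?_)
  have h₁ := T.corner_eq_par_iff hi c
  have h₂ := T.corner_eq_par_iff hj c
  rw [h c, hpar, h₂] at h₁
  exact (not_iff_not.1 h₁).symm

/-- The graph on the first `m` triangles. -/
def graph (m : ℕ) : SimpleGraph (Fin m × Fin 3) where
  Adj x y := x.2 ≠ y.2 ∧
    ((x.1 : ℕ) = y.1 ∨ T.corner x.1 y.2 = y.1 ∨ T.corner y.1 x.2 = x.1)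
  symm := ⟨fun x y h => ⟨h.1.symm, by have := h.2; omega⟩⟩
  loopless := ⟨fun x h => h.1 rfl⟩

variable {m : ℕ}

theorem graph_adj {x y : Fin m × Fin 3} : (T.graph m).Adj x y ↔ x.2 ≠ y.2 ∧
    ((x.1 : ℕ) = y.1 ∨ T.corner x.1 y.2 = y.1 ∨ T.corner y.1 x.2 = x.1) := Iff.rfl

/-- The corner of color `c` of the face into which triangle `i` is inserted. -/
def cornerVertex (i : Fin m) (c : Fin 3) : Fin m × Fin 3 :=
  (⟨T.corner i c, (T.corner_le i c).trans_lt i.2⟩, c)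

@[simp] theorem cornerVertex_fst (i : Fin m) (c : Fin 3) :
    ((T.cornerVertex i c).1 : ℕ) = T.corner i c := rfl

@[simp] theorem cornerVertex_snd (i : Fin m) (c : Fin 3) : (T.cornerVertex i c).2 = c := rfl

theorem adj_cornerVertex (i : Fin m) {c d : Fin 3} (h : c ≠ d) :
    (T.graph m).Adj (i, c) (T.cornerVertex i d) :=
  ⟨h, Or.inr (Or.inl rfl)⟩

theorem adj_level (i : Fin m) {c d : Fin 3} (h : c ≠ d) : (T.graph m).Adj (i, c) (i, d) :=
  ⟨h, Or.inl rfl⟩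

theorem cornerVertex_adj_cornerVertex (i : Fin m) {c d : Fin 3} (h : c ≠ d) :
    (T.graph m).Adj (T.cornerVertex i c) (T.cornerVertex i d) := by
  refine ⟨h, ?_⟩
  simp only [cornerVertex_fst, cornerVertex_snd]
  rcases Nat.eq_zero_or_pos (i : ℕ) with hi | hi
  · simp [hi, T.corner_zero]
  · rw [T.corner_eq i c hi, T.corner_eq i d hi]
    split_ifs with h₁ h₂ <;> simp_all

/-- Every vertex has as many neighbors of one other color as of the third color. -/
theorem isEulerian_graph : IsEulerian (T.graph m) := by
  rintro ⟨j, c⟩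
  let A : Set (Fin m) := {i | i = j ∨ T.corner i c = j}
  let N (d : Fin 3) : Set (Fin m × Fin 3) := (·, d) '' insert (T.cornerVertex j d).1 A
  have hN (d e : Fin 3) : (N d).ncard = (N e).ncard := by
    have hinj (d : Fin 3) : Function.Injective (fun i : Fin m => (i, d)) :=
      fun x y h => (Prod.ext_iff.1 h).1
    simp only [N, Set.ncard_image_of_injective _ (hinj _)]
    rcases Nat.eq_zero_or_pos (j : ℕ) with hj | hj
    · have (d : Fin 3) : (T.cornerVertex j d).1 = j :=
        Fin.ext (by rw [cornerVertex_fst, hj, T.corner_zero])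
      rw [this, this]
    · have (d : Fin 3) : (T.cornerVertex j d).1 ∉ A := by
        have h₁ := T.corner_lt hj d
        rintro (h | h)
        · have := congrArg Fin.val h
          simp only [cornerVertex_fst] at this
          omega
        · have h₂ := T.corner_le (T.cornerVertex j d).1 c
          simp only [cornerVertex_fst] at h h₂
          omega
      rw [Set.ncard_insert_of_notMem (this d), Set.ncard_insert_of_notMem (this e)]
  have hunion : (T.graph m).neighborSet (j, c) = N (c + 1) ∪ N (c + 2) := by
    have hcolor : ∀ c d : Fin 3, c ≠ d ↔ c + 1 = d ∨ c + 2 = d := by decide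
    ext ⟨i, d⟩
    simp only [SimpleGraph.mem_neighborSet, graph_adj, N, A, Set.mem_union, Set.mem_image,
      Set.mem_insert_iff, Prod.mk.injEq, hcolor, Set.mem_ofPred_eq, Fin.ext_iff (n := m),
      cornerVertex_fst]
    constructor
    · rintro ⟨rfl | rfl, h⟩
      · exact Or.inl ⟨i, by omega, rfl, rfl⟩
      · exact Or.inr ⟨i, by omega, rfl, rfl⟩
    · rintro (⟨i', h, h', rfl⟩ | ⟨i', h, h', rfl⟩)
      · obtain rfl := Fin.ext h'
        exact ⟨Or.inl rfl, by omega⟩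
      · obtain rfl := Fin.ext h'
        exact ⟨Or.inr rfl, by omega⟩
  rw [hunion, Set.ncard_union_eq, hN (c + 2) (c + 1)]
  · exact ⟨_, rfl⟩
  · rw [Set.disjoint_left]
    rintro _ ⟨i, -, rfl⟩ ⟨i', -, h⟩
    have hne : ∀ c : Fin 3, c + 2 ≠ c + 1 := by decide
    exact hne c (Prod.ext_iff.1 h).2

/-- The vertices of the triangles before triangle `j` other than the corners of the face into which
triangle `j` is inserted. -/
def outside (j : Fin m) : Set (Fin m × Fin 3) :=
  {x | (x.1 : ℕ) < j ∧ T.corner j x.2 ≠ x.1}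

theorem exists_reachable_level_zero (j : Fin m) (x : T.outside j) :
    ∃ y : T.outside j, (y.1.1 : ℕ) = 0 ∧ ((T.graph m).induce (T.outside j)).Reachable x y := by
  obtain ⟨⟨i, c⟩, hx⟩ := x
  induction hn : (i : ℕ) using Nat.strong_induction_on generalizing i c with
  | _ n ih =>
    subst hn
    rcases Nat.eq_zero_or_pos (i : ℕ) with hi | hi
    · exact ⟨_, hi, .rfl⟩
    · have hij : (i : ℕ) < j := hx.1
      have step (y : T.outside j) (d : Fin 3) (hyi : y.1.1 = i) (hyd : y.1.2 ≠ d)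
          (hd : T.corner i d ≠ T.corner j d) : ∃ z : T.outside j, (z.1.1 : ℕ) = 0 ∧
          ((T.graph m).induce (T.outside j)).Reachable y z := by
        have hlt := T.corner_lt hi d
        have hmem : T.cornerVertex i d ∈ T.outside j :=
          ⟨by rw [cornerVertex_fst]; omega, fun h => hd h.symm⟩
        obtain ⟨z, hz, hr⟩ := ih _ hlt (T.cornerVertex i d).1 d hmem rfl
        refine ⟨z, hz, SimpleGraph.Reachable.trans (SimpleGraph.Adj.reachable ?_) hr⟩
        obtain ⟨⟨y, c'⟩, hy⟩ := y
        subst hyi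
        exact T.adj_cornerVertex _ hyd
      by_cases h₁ : T.corner i (c + 1) = T.corner j (c + 1)
      · by_cases h₂ : T.corner i (c + 2) = T.corner j (c + 2)
        · have h₀ : T.corner i c ≠ T.corner j c := by
            intro h₀
            have hcol : ∀ c d : Fin 3, d = c ∨ d = c + 1 ∨ d = c + 2 := by decide
            refine hij.ne (T.corner_injective hi (hi.trans hij) fun d => ?_)
            rcases hcol c d with rfl | rfl | rfl <;> assumption
          have hlt := T.corner_lt hi (c + 1)
          have hmem : (i, c + 1) ∈ T.outside j := ⟨hij, fun h => by simp only at h; omega⟩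
          have hcc : c ≠ c + 1 := by simp
          obtain ⟨z, hz, hr⟩ := step ⟨(i, c + 1), hmem⟩ c rfl hcc.symm h₀
          have hadj : ((T.graph m).induce (T.outside j)).Adj ⟨(i, c), hx⟩ ⟨(i, c + 1), hmem⟩ :=
            T.adj_level i hcc
          exact ⟨z, hz, hadj.reachable.trans hr⟩
        · exact step _ _ rfl (by simp) h₂
      · exact step _ _ rfl (by simp) h₁

theorem connected_outside {j : Fin m} (hne : (T.outside j).Nonempty) :
    ((T.graph m).induce (T.outside j)).Connected := by
  have : Nonempty (T.outside j) := hne.to_subtype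
  refine ⟨fun x y => ?_⟩
  obtain ⟨x', hx', hx⟩ := T.exists_reachable_level_zero j x
  obtain ⟨y', hy', hy⟩ := T.exists_reachable_level_zero j y
  refine hx.trans (SimpleGraph.Reachable.trans ?_ hy.symm)
  by_cases h : x' = y'
  · rw [h]
  · refine SimpleGraph.Adj.reachable ⟨fun hc => h ?_, Or.inl (hx'.trans hy'.symm)⟩
    exact Subtype.ext (Prod.ext (Fin.ext (hx'.trans hy'.symm)) hc)

theorem exists_outside_adj {j : Fin m} (hne : (T.outside j).Nonempty) (c : Fin 3) :
    ∃ x ∈ T.outside j, (T.graph m).Adj (T.cornerVertex j c) x := by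
  obtain ⟨u, hu⟩ := hne
  have hj : 0 < (j : ℕ) := (Nat.zero_le _).trans_lt hu.1
  have hpar := T.par_lt j hj
  let p : Fin m := ⟨T.par j, hpar.trans j.2⟩
  rcases hk : T.kind j with - | d
  · have hcor (c : Fin 3) : T.corner j c = p := by simp [T.corner_eq j c hj, hk, p]
    have hp : 0 < (p : ℕ) := by
      by_contra hp
      have hp0 : T.par j = 0 := by simpa [p] using hp
      have hone : T.par 1 = 0 := by simpa using T.par_lt 1 one_pos
      have hkone : T.kind 1 = none := by
        by_contra h
        obtain ⟨d, hd⟩ := Option.ne_none_iff_exists'.1 h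
        exact (T.par_pos 1 d one_pos hd).ne' hone
      have hj1 : (j : ℕ) = 1 := T.kind_inj j 1 hj one_pos (hp0.trans hone.symm) (hk.trans hkone.symm)
      have h₁ := hu.1
      have h₂ := hu.2
      rw [hcor] at h₂
      simp only [p] at h₂
      omega
    have hlt := T.corner_lt hp (c + 1)
    refine ⟨T.cornerVertex p (c + 1), ⟨?_, ?_⟩, ?_⟩
    · rw [cornerVertex_fst]
      exact hlt.trans hpar
    · rw [hcor, cornerVertex_fst]
      exact hlt.ne'
    · have : T.cornerVertex j c = (p, c) := Prod.ext (Fin.ext (hcor c)) rfl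
      rw [this]
      exact T.adj_cornerVertex p (by simp)
  · have hp : 0 < (p : ℕ) := T.par_pos j d hj hk
    have hcor (c : Fin 3) : T.corner j c = if d = c then T.corner p d else (p : ℕ) := by
      rw [T.corner_eq j c hj, hk]
      by_cases h : d = c <;> simp [h, p]
    by_cases hcd : d = c
    · subst hcd
      have hne : d ≠ d + 1 := by simp
      have : T.cornerVertex j d = T.cornerVertex p d :=
        Prod.ext (Fin.ext (by simp [hcor])) rfl
      have hlt := T.corner_lt hp (d + 1)
      refine ⟨T.cornerVertex p (d + 1), ⟨?_, ?_⟩, this ▸ T.cornerVertex_adj_cornerVertex p hne⟩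
      · rw [cornerVertex_fst]
        exact hlt.trans hpar
      · rw [cornerVertex_snd, hcor, if_neg hne, cornerVertex_fst]
        exact hlt.ne'
    · have : T.cornerVertex j c = (p, c) := Prod.ext (Fin.ext (by simp [hcor, hcd])) rfl
      refine ⟨(p, d), ⟨hpar, ?_⟩, this ▸ T.adj_level p (Ne.symm hcd)⟩
      rw [hcor, if_pos rfl]
      exact (T.corner_lt hp d).ne

theorem hasCliqueMinor_of_adj {G : SimpleGraph (Fin m × Fin 3)} (hG : T.graph m ≤ G)
    {u v : Fin m × Fin 3} (huv : G.Adj u v) (hn : ¬ (T.graph m).Adj u v) (hlt : u.1 < v.1) :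
    HasCliqueMinor G 5 := by
  obtain ⟨j, d⟩ := v
  have hj : 0 < (j : ℕ) := (Nat.zero_le _).trans_lt hlt
  have hcor (c : Fin 3) : ((T.cornerVertex j c).1 : ℕ) < j := T.corner_lt hj c
  have hlevel (c e : Fin 3) : T.cornerVertex j c ≠ (j, e) := fun h => by
    have := hcor c
    rw [h] at this
    exact lt_irrefl _ this
  have hclique (S : Set (Fin m × Fin 3)) (hS : ∀ x ∈ S, x.1 = j) : G.IsClique S := by
    intro x hx y hy hxy
    refine hG ⟨fun h => hxy (Prod.ext ((hS x hx).trans (hS y hy).symm) h), Or.inl ?_⟩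
    rw [hS x hx, hS y hy]
  by_cases hu : u = T.cornerVertex j d
  · refine hasCliqueMinor_five_of_triangle (T.cornerVertex j) (L := {(j, d)})
      (M := {(j, d + 1), (j, d + 2)})
      (fun c e h => hG (T.cornerVertex_adj_cornerVertex j h))
      (connected_induce_of_isClique (SimpleGraph.isClique_singleton _) (Set.singleton_nonempty _))
      (connected_induce_of_isClique (hclique _ (by simp)) (Set.insert_nonempty _ _))
      (by simp) (by simp [hlevel]) (by simp [hlevel]) ?_ ?_ ?_
    · intro c
      refine ⟨_, rfl, ?_⟩
      by_cases h : c = d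
      · rw [h, ← hu]
        exact huv
      · exact (hG (T.adj_cornerVertex j (Ne.symm h))).symm
    · intro c
      by_cases h : c = d + 1
      · exact ⟨(j, d + 2), by simp, (hG (T.adj_cornerVertex j (by simp [h]))).symm⟩
      · exact ⟨(j, d + 1), by simp, (hG (T.adj_cornerVertex j (Ne.symm h))).symm⟩
    · exact ⟨_, rfl, (j, d + 1), by simp, hG (T.adj_level j (by simp))⟩
  · have hmem : u ∈ T.outside j := by
      refine ⟨hlt, fun h => hn ⟨fun hc => hu ?_, Or.inr (Or.inr h)⟩⟩
      subst hc
      exact Prod.ext (Fin.ext h.symm) rfl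
    have hmono : (T.graph m).induce (T.outside j) ≤ G.induce (T.outside j) :=
      fun x y h => hG h
    refine hasCliqueMinor_five_of_triangle (T.cornerVertex j) (L := T.outside j)
      (M := {x | x.1 = j})
      (fun c e h => hG (T.cornerVertex_adj_cornerVertex j h))
      ((T.connected_outside ⟨u, hmem⟩).mono hmono)
      (connected_induce_of_isClique (hclique _ fun x hx => hx) ⟨(j, 0), rfl⟩) ?_
      (fun c h => h.2 rfl) (fun c h => hlevel c c (Prod.ext h rfl)) ?_ ?_
      ⟨u, hmem, _, rfl, huv⟩
    · rw [Set.disjoint_left]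
      intro x hx h
      have := hx.1
      rw [show x.1 = j from h] at this
      exact lt_irrefl _ this
    · intro c
      obtain ⟨x, hx, h⟩ := T.exists_outside_adj ⟨u, hmem⟩ c
      exact ⟨x, hx, hG h⟩
    · intro c
      exact ⟨(j, c + 1), rfl, (hG (T.adj_cornerVertex j (by simp))).symm⟩

/-- Adding an edge to the graph of iterated octahedron insertions destroys planarity. -/
theorem not_isPlanar_sup_edge {u v : Fin m × Fin 3} (huv : u ≠ v) (hn : ¬ (T.graph m).Adj u v) :
    ¬ IsPlanar (T.graph m ⊔ SimpleGraph.fromEdgeSet {s(u, v)}) := by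
  rintro ⟨E⟩
  apply E.not_hasCliqueMinor_five
  have hadj : (T.graph m ⊔ SimpleGraph.fromEdgeSet {s(u, v)}).Adj u v :=
    Or.inr (by simp [huv])
  rcases lt_trichotomy u.1 v.1 with h | h | h
  · exact T.hasCliqueMinor_of_adj le_sup_left hadj hn h
  · exact absurd ⟨fun hc => huv (Prod.ext h hc), Or.inl (by rw [h])⟩ hn
  · exact T.hasCliqueMinor_of_adj le_sup_left hadj.symm (fun h => hn h.symm) h

end InsertionTree

/-! ### Coordinates with respect to a triangular face -/

/-- Barycentric coordinates of the vertex of color `c` of a triangle inserted into a face. -/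
noncomputable def innerPoint (c : Fin 3) : Fin 3 → ℝ := fun d => if d = c then 1 / 5 else 2 / 5

/-- Barycentric coordinates of the corner of color `c` of a child face of kind `k`. -/
noncomputable def childCorner (k : Option (Fin 3)) (c : Fin 3) : Fin 3 → ℝ :=
  if k = some c then Pi.single c 1 else innerPoint c

/-- The coordinate change from a child face of kind `k` to its parent face. -/
noncomputable def childMap (k : Option (Fin 3)) : (Fin 3 → ℝ) →ₗ[ℝ] (Fin 3 → ℝ) :=
  Fintype.linearCombination ℝ (childCorner k)

/-- The plane of barycentric coordinates. -/
def baryPlane : Set (Fin 3 → ℝ) := {x | x 0 + x 1 + x 2 = 1}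

/-- Barycentric coordinates of the points in the interior of a face. -/
def openFace : Set (Fin 3 → ℝ) := {x | x ∈ baryPlane ∧ ∀ c, 0 < x c}

/-- A region, given by linear inequalities, that contains the interior of the child face of
kind `k`. -/
def childRegion : Option (Fin 3) → Set (Fin 3 → ℝ)
  | none => {x | ∀ c, x c < 2 / 5}
  | some c => {x | 2 / 5 < x c ∧ ∀ a b, a ≠ c → b ≠ c → a ≠ b → x a < 2 * x b}

theorem childMap_single (k : Option (Fin 3)) (c : Fin 3) :
    childMap k (Pi.single c 1) = childCorner k c := by
  simp [childMap]

theorem childMap_apply (k : Option (Fin 3)) (y : Fin 3 → ℝ) (d : Fin 3) : childMap k y d =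
    y 0 * childCorner k 0 d + y 1 * childCorner k 1 d + y 2 * childCorner k 2 d := by
  simp [childMap, Fintype.linearCombination_apply, Fin.sum_univ_three]

theorem childMap_mem_baryPlane (k : Option (Fin 3)) {y : Fin 3 → ℝ} (hy : y ∈ baryPlane) :
    childMap k y ∈ baryPlane := by
  have hy : y 0 + y 1 + y 2 = 1 := hy
  change childMap k y 0 + childMap k y 1 + childMap k y 2 = 1
  simp only [childMap_apply]
  rcases k with - | k
  · simp [childCorner, innerPoint]
    linarith
  · fin_cases k <;> simp [childCorner, innerPoint] <;> linarith

theorem childMap_injective (k : Option (Fin 3)) : Function.Injective (childMap k) := by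
  intro y z h
  have h₀ := congrFun h 0
  have h₁ := congrFun h 1
  have h₂ := congrFun h 2
  simp only [childMap_apply] at h₀ h₁ h₂
  ext c
  rcases k with - | k
  · simp [childCorner, innerPoint] at h₀ h₁ h₂
    fin_cases c <;> simp <;> linarith
  · fin_cases k <;> simp [childCorner, innerPoint] at h₀ h₁ h₂ <;>
      fin_cases c <;> simp <;> linarith

theorem childMap_mem_openFace (k : Option (Fin 3)) {y : Fin 3 → ℝ} (hy : y ∈ openFace) :
    childMap k y ∈ openFace := by
  refine ⟨childMap_mem_baryPlane k hy.1, fun c => ?_⟩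
  have h₀ := hy.2 0
  have h₁ := hy.2 1
  have h₂ := hy.2 2
  simp only [childMap_apply]
  rcases k with - | k
  · fin_cases c <;> simp [childCorner, innerPoint] <;> linarith
  · fin_cases k <;> fin_cases c <;> simp [childCorner, innerPoint] <;> linarith

theorem childMap_mem_childRegion (k : Option (Fin 3)) {y : Fin 3 → ℝ} (hy : y ∈ openFace) :
    childMap k y ∈ childRegion k := by
  have h : y 0 + y 1 + y 2 = 1 := hy.1
  have h₀ := hy.2 0
  have h₁ := hy.2 1
  have h₂ := hy.2 2
  rcases k with - | k
  · intro c
    simp only [childMap_apply]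
    fin_cases c <;> simp [childCorner, innerPoint] <;> linarith
  · refine ⟨?_, fun a b ha hb hab => ?_⟩
    · simp only [childMap_apply]
      fin_cases k <;> simp [childCorner, innerPoint] <;> linarith
    · simp only [childMap_apply]
      fin_cases k <;> fin_cases a <;> simp at ha <;> fin_cases b <;> simp at hb hab <;>
        simp [childCorner, innerPoint] <;> linarith

theorem exists_third (c d : Fin 3) (h : c ≠ d) : ∃ e, c ≠ e ∧ d ≠ e := by
  revert c d; decide

theorem sum_eq_of_distinct (x : Fin 3 → ℝ) {c d e : Fin 3} (h₁ : c ≠ d) (h₂ : c ≠ e)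
    (h₃ : d ≠ e) : x c + x d + x e = x 0 + x 1 + x 2 := by
  fin_cases c <;> fin_cases d <;> simp at h₁ <;> fin_cases e <;> simp at h₂ h₃ <;> simp <;> ring

theorem eq_of_distinct {c d e : Fin 3} (h₁ : c ≠ d) (h₂ : c ≠ e) (h₃ : d ≠ e) (f : Fin 3) :
    f = c ∨ f = d ∨ f = e := by
  revert c d e f; decide

theorem disjoint_childRegion {k l : Option (Fin 3)} (hkl : k ≠ l) {x : Fin 3 → ℝ}
    (hx : x ∈ baryPlane) (hk : x ∈ childRegion k) : x ∉ childRegion l := by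
  intro hl
  rcases k with - | c <;> rcases l with - | d
  · exact hkl rfl
  · exact lt_asymm hl.1 (hk d)
  · exact lt_asymm hk.1 (hl c)
  · have hcd : c ≠ d := fun h => hkl (congrArg some h)
    obtain ⟨e, hce, hde⟩ := exists_third c d hcd
    have h₁ := sum_eq_of_distinct x hcd hce hde
    have h₂ : x 0 + x 1 + x 2 = 1 := hx
    have h₃ := hk.2 d e hcd.symm hce.symm hde
    have h₄ := hk.1
    have h₅ := hl.1
    linarith

/-! ### Edges in the coordinates of a face -/

/-- The second endpoint of an edge at the inner point of some color other than `d`: the inner point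
(`b = true`) or the corner (`b = false`) of color `d`. -/
noncomputable def localEnd (d : Fin 3) (b : Bool) : Fin 3 → ℝ :=
  bif b then innerPoint d else Pi.single d 1

/-- A convex set containing the edge from the inner point of color `c` to the point
`localEnd d b`. -/
def edgeRegion (c d : Fin 3) : Bool → Set (Fin 3 → ℝ)
  | true => {x | (∀ e, x e ≤ 2 / 5) ∧ ∀ e, c ≠ e → d ≠ e → x e = 2 / 5}
  | false => {x | 2 / 5 ≤ x d ∧ ∀ e, c ≠ e → d ≠ e → x e = 2 * x c}

theorem innerPoint_mem_openFace (c : Fin 3) : innerPoint c ∈ openFace := by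
  refine ⟨?_, fun d => ?_⟩
  · change innerPoint c 0 + innerPoint c 1 + innerPoint c 2 = 1
    fin_cases c <;> simp [innerPoint] <;> norm_num
  · unfold innerPoint
    split_ifs <;> norm_num

theorem single_mem_baryPlane (c : Fin 3) : Pi.single c 1 ∈ baryPlane := by
  change (Pi.single c 1 : Fin 3 → ℝ) 0 + (Pi.single c 1 : Fin 3 → ℝ) 1 +
    (Pi.single c 1 : Fin 3 → ℝ) 2 = 1
  fin_cases c <;> simp

theorem localEnd_mem_baryPlane (d : Fin 3) (b : Bool) : localEnd d b ∈ baryPlane := by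
  cases b
  · exact single_mem_baryPlane d
  · exact (innerPoint_mem_openFace d).1

theorem innerPoint_injective : Function.Injective innerPoint := by
  intro c d h
  have := congrFun h c
  by_contra hcd
  simp [innerPoint, hcd] at this
  norm_num at this

theorem convex_baryPlane : Convex ℝ baryPlane := by
  intro x hx y hy a b _ _ hab
  have hx : x 0 + x 1 + x 2 = 1 := hx
  have hy : y 0 + y 1 + y 2 = 1 := hy
  change a * x 0 + b * y 0 + (a * x 1 + b * y 1) + (a * x 2 + b * y 2) = 1
  linear_combination a * hx + b * hy + hab

theorem localEdge_subset_baryPlane (c d : Fin 3) (b : Bool) :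
    segment ℝ (innerPoint c) (localEnd d b) ⊆ baryPlane :=
  convex_baryPlane.segment_subset (innerPoint_mem_openFace c).1 (localEnd_mem_baryPlane d b)

theorem localEdge_subset_edgeRegion {c d : Fin 3} (hcd : c ≠ d) (b : Bool) :
    segment ℝ (innerPoint c) (localEnd d b) ⊆ edgeRegion c d b := by
  rintro _ ⟨s, t, hs, ht, hst, rfl⟩
  cases b
  · refine ⟨?_, fun e hce hde => ?_⟩
    · simp [localEnd, innerPoint, hcd.symm]
      linarith
    · simp [localEnd, innerPoint, hcd, hce.symm, hde.symm]
      ring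
  · refine ⟨fun e => ?_, fun e hce hde => ?_⟩
    · simp only [localEnd, innerPoint, Pi.add_apply, Pi.smul_apply, smul_eq_mul, cond_true]
      split_ifs <;> linarith
    · simp [localEnd, innerPoint, hce.symm, hde.symm]
      linarith

/-- An edge lies in the interior of the face except possibly for its second endpoint. -/
theorem mem_openFace_of_mem_localEdge {c d : Fin 3} {b : Bool} {x : Fin 3 → ℝ}
    (hx : x ∈ segment ℝ (innerPoint c) (localEnd d b)) :
    x ∈ openFace ∨ b = false ∧ x = Pi.single d 1 := by
  have hplane := localEdge_subset_baryPlane c d b hx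
  obtain ⟨s, t, hs, ht, hst, rfl⟩ := hx
  have hc := (innerPoint_mem_openFace c).2
  have hd := (innerPoint_mem_openFace d).2
  rcases hs.eq_or_lt with rfl | hs
  · have : t = 1 := by linarith
    subst this
    cases b
    · right
      simp [localEnd]
    · left
      simpa [localEnd] using innerPoint_mem_openFace d
  · refine Or.inl ⟨hplane, fun e => ?_⟩
    have h₁ : 0 < s * innerPoint c e := mul_pos hs (hc e)
    have h₂ : 0 ≤ localEnd d b e := by
      cases b
      · by_cases h : e = d
        · simp [localEnd, h]
        · simp [localEnd, h]
      · exact (hd e).le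
    have h₃ := mul_nonneg ht h₂
    simpa using add_pos_of_pos_of_nonneg h₁ h₃

theorem notMem_childRegion_of_mem_edgeRegion {c d : Fin 3} (hcd : c ≠ d) {b : Bool}
    {x : Fin 3 → ℝ} (hx : x ∈ baryPlane) (hb : x ∈ edgeRegion c d b) (k : Option (Fin 3)) :
    x ∉ childRegion k := by
  intro hk
  obtain ⟨e, hce, hde⟩ := exists_third c d hcd
  have h₁ := sum_eq_of_distinct x hcd hce hde
  have h₂ : x 0 + x 1 + x 2 = 1 := hx
  cases b
  · obtain ⟨h₃, h₄⟩ := hb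
    have h₄ := h₄ e hce hde
    rcases k with - | f
    · exact (hk d).not_ge h₃
    · obtain ⟨h₅, h₆⟩ := hk
      rcases eq_of_distinct hcd hce hde f with rfl | rfl | rfl
      · have := h₆ d e hcd.symm hce.symm hde
        linarith
      · have := h₆ e c hde.symm hcd hce.symm
        linarith
      · have := h₆ d c hde hce hcd.symm
        linarith
  · rcases k with - | f
    · have := hk e
      have := hb.2 e hce hde
      linarith
    · exact hk.1.not_ge (hb.1 f)

theorem eq_or_eq_of_innerPoint_mem {c d f : Fin 3} (hcd : c ≠ d) {b : Bool}
    (h : innerPoint f ∈ edgeRegion c d b) : f = c ∨ b = true ∧ f = d := by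
  obtain ⟨e, hce, hde⟩ := exists_third c d hcd
  cases b
  · have h₁ := h.2 e hce hde
    rcases eq_of_distinct hcd hce hde f with rfl | rfl | rfl
    · exact Or.inl rfl
    · norm_num [innerPoint, hcd, hde.symm] at h₁
    · norm_num [innerPoint, hce] at h₁
  · have h₁ := h.2 e hce hde
    rcases eq_of_distinct hcd hce hde f with rfl | rfl | rfl
    · exact Or.inl rfl
    · exact Or.inr ⟨rfl, rfl⟩
    · norm_num [innerPoint] at h₁

theorem eq_innerPoint {c d e : Fin 3} (hcd : c ≠ d) (hce : c ≠ e) (hde : d ≠ e) {x : Fin 3 → ℝ}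
    (hc : x c = 1 / 5) (hd : x d = 2 / 5) (he : x e = 2 / 5) : x = innerPoint c := by
  ext f
  rcases eq_of_distinct hcd hce hde f with rfl | rfl | rfl
  · simp [innerPoint, hc]
  · simp [innerPoint, hd, hcd.symm]
  · simp [innerPoint, he, hce.symm]

/-- Distinct edges inserted into the same face only meet in inner points and corners. -/
theorem eq_of_mem_edgeRegion {c d c' d' : Fin 3} {b b' : Bool} (hcd : c ≠ d) (hcd' : c' ≠ d')
    {x : Fin 3 → ℝ} (hx : x ∈ baryPlane) (h : x ∈ edgeRegion c d b) (h' : x ∈ edgeRegion c' d' b')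
    (hne : ¬ (b = b' ∧ (c = c' ∧ d = d' ∨ b = true ∧ c = d' ∧ d = c'))) :
    (∃ f, x = innerPoint f) ∨ b = false ∧ ∃ f, x = Pi.single f 1 := by
  have hside {c d c' d' : Fin 3} (hcd : c ≠ d) (hcd' : c' ≠ d') (h : x ∈ edgeRegion c d true)
      (h' : x ∈ edgeRegion c' d' false) : ∃ f, x = innerPoint f := by
    obtain ⟨e, hce, hde⟩ := exists_third c' d' hcd'
    have h₁ := sum_eq_of_distinct x hcd' hce hde
    have h₂ : x 0 + x 1 + x 2 = 1 := hx
    have h₃ := h.1 d'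
    have h₄ := h'.1
    have h₅ := h'.2 e hce hde
    exact ⟨c', eq_innerPoint hcd' hce hde (by linarith) (by linarith) (by linarith)⟩
  obtain ⟨e, hce, hde⟩ := exists_third c d hcd
  have h₁ := sum_eq_of_distinct x hcd hce hde
  have h₂ : x 0 + x 1 + x 2 = 1 := hx
  cases b <;> cases b'
  · obtain ⟨h₃, h₄⟩ := h
    obtain ⟨h₅, h₆⟩ := h'
    have h₄ := h₄ e hce hde
    rcases eq_of_distinct hcd hce hde d' with rfl | rfl | rfl
    · rcases eq_of_distinct hcd hce hde c' with rfl | rfl | rfl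
      · exact absurd rfl hcd'
      · have := h₆ e hde hce
        linarith
      · have := h₆ d hde.symm hcd
        exact Or.inl ⟨c', eq_innerPoint hce.symm hde.symm hcd (by linarith) (by linarith)
          (by linarith)⟩
    · rcases eq_of_distinct hcd hce hde c' with rfl | rfl | rfl
      · simp at hne
      · exact absurd rfl hcd'
      · have := h₆ c hce.symm hcd.symm
        refine Or.inr ⟨rfl, d', ?_⟩
        ext f
        rcases eq_of_distinct hcd hce hde f with rfl | rfl | rfl
        · simp [hcd]; linarith
        · simp; linarith
        · simp [hde.symm]; linarith
    · rcases eq_of_distinct hcd hce hde c' with rfl | rfl | rfl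
      · have := h₆ d hcd hde.symm
        exact Or.inl ⟨c', eq_innerPoint hcd hce hde (by linarith) (by linarith) (by linarith)⟩
      · have := h₆ c hcd.symm hce.symm
        linarith
      · exact absurd rfl hcd'
  · exact Or.inl (hside hcd' hcd h' h)
  · exact Or.inl (hside hcd hcd' h h')
  · have h₃ := h.2 e hce hde
    obtain ⟨e', hce', hde'⟩ := exists_third c' d' hcd'
    have h₄ := h'.2 e' hce' hde'
    rcases eq_of_distinct hcd hce hde e' with rfl | rfl | rfl
    · exact Or.inl ⟨d, eq_innerPoint hcd.symm hde hce (by linarith) (by linarith) (by linarith)⟩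
    · exact Or.inl ⟨c, eq_innerPoint hcd hce hde (by linarith) (by linarith) (by linarith)⟩
    · refine absurd ⟨rfl, ?_⟩ hne
      revert hcd hce hde hcd' hce' hde'
      clear * -
      revert c d c' d' e'
      decide

namespace InsertionTree

variable (T : InsertionTree) {m : ℕ}

/-! ### The straight-line drawing -/

/-- The map from barycentric coordinates with respect to the face into which triangle `i` is
inserted to the plane. -/
noncomputable def chart (i : ℕ) : (Fin 3 → ℝ) →ₗ[ℝ] ℝ × ℝ :=
  if _h : 0 < i then chart (T.par i) ∘ₗ childMap (T.kind i)
  else (LinearMap.proj 0).prod (LinearMap.proj 1)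
termination_by i
decreasing_by exact T.par_lt i _h

theorem chart_of_pos {i : ℕ} (hi : 0 < i) (x : Fin 3 → ℝ) :
    T.chart i x = T.chart (T.par i) (childMap (T.kind i) x) := by
  rw [chart, dif_pos hi]
  rfl

theorem chart_injOn (i : ℕ) : Set.InjOn (T.chart i) baryPlane := by
  induction i using Nat.strong_induction_on with
  | _ i ih =>
    intro x hx y hy h
    rcases Nat.eq_zero_or_pos i with rfl | hi
    · have hx : x 0 + x 1 + x 2 = 1 := hx
      have hy : y 0 + y 1 + y 2 = 1 := hy
      rw [chart, dif_neg (lt_irrefl 0)] at h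
      have h₀ : x 0 = y 0 := congrArg Prod.fst h
      have h₁ : x 1 = y 1 := congrArg Prod.snd h
      have h₂ : x 2 = y 2 := by linarith
      ext c
      fin_cases c <;> assumption
    · rw [T.chart_of_pos hi, T.chart_of_pos hi] at h
      exact childMap_injective _ (ih _ (T.par_lt i hi) (childMap_mem_baryPlane _ hx)
        (childMap_mem_baryPlane _ hy) h)

/-- The interior of the face into which triangle `i` is inserted. -/
def face (i : ℕ) : Set (ℝ × ℝ) := T.chart i '' openFace

theorem face_subset_face_par {i : ℕ} (hi : 0 < i) : T.face i ⊆ T.face (T.par i) := by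
  rintro _ ⟨x, hx, rfl⟩
  exact ⟨_, childMap_mem_openFace _ hx, (T.chart_of_pos hi x).symm⟩

theorem disjoint_face {i j : ℕ} (hij : i < j) (hj : T.par j < i) :
    Disjoint (T.face i) (T.face j) := by
  induction hn : i + j using Nat.strong_induction_on generalizing i j with
  | _ n ih =>
    subst hn
    have hi₀ : 0 < i := by omega
    have hj₀ : 0 < j := by omega
    have hi := T.par_lt i hi₀
    rcases lt_trichotomy (T.par i) (T.par j) with h | h | h
    · exact ((ih _ (by omega) hj h rfl).symm).mono_right (T.face_subset_face_par hj₀)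
    · have hkind : T.kind i ≠ T.kind j := fun hk => hij.ne (T.kind_inj i j hi₀ hj₀ h hk)
      rw [Set.disjoint_left]
      rintro _ ⟨x, hx, rfl⟩ ⟨y, hy, hxy⟩
      rw [T.chart_of_pos hi₀, T.chart_of_pos hj₀, h] at hxy
      have hx' := childMap_mem_baryPlane (T.kind i) hx.1
      have e := T.chart_injOn _ (childMap_mem_baryPlane _ hy.1) hx' hxy
      exact disjoint_childRegion hkind hx' (childMap_mem_childRegion _ hx)
        (e ▸ childMap_mem_childRegion _ hy)
    · exact (ih _ (by omega) (hi.trans hij) h rfl).mono_left (T.face_subset_face_par hi₀)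

/-- The point representing the vertex of color `c` of triangle `i`. -/
noncomputable def point (i : ℕ) (c : Fin 3) : ℝ × ℝ := T.chart i (innerPoint c)

theorem point_mem_face (i : ℕ) (c : Fin 3) : T.point i c ∈ T.face i :=
  ⟨_, innerPoint_mem_openFace c, rfl⟩

theorem chart_single {i : ℕ} (hi : 0 < i) (c : Fin 3) :
    T.chart i (Pi.single c 1) = T.point (T.corner i c) c := by
  induction i using Nat.strong_induction_on with
  | _ i ih =>
    rw [T.chart_of_pos hi, childMap_single, T.corner_eq i c hi, childCorner]
    split_ifs with h
    · exact ih _ (T.par_lt i hi) (T.par_pos i c hi h)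
    · rfl

/-- The index of the triangle containing the second endpoint of an edge. -/
def endLevel (i : ℕ) (d : Fin 3) (b : Bool) : ℕ := bif b then i else T.corner i d

theorem chart_localEnd {i : ℕ} {b : Bool} (hb : b = false → 0 < i) (d : Fin 3) :
    T.chart i (localEnd d b) = T.point (T.endLevel i d b) d := by
  cases b
  · exact T.chart_single (hb rfl) d
  · rfl

theorem chart_image_localEdge {i : ℕ} {b : Bool} (hb : b = false → 0 < i) (c d : Fin 3) :
    T.chart i '' segment ℝ (innerPoint c) (localEnd d b) =
      segment ℝ (T.point i c) (T.point (T.endLevel i d b) d) := by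
  rw [← T.chart_localEnd hb d]
  exact image_segment ℝ (T.chart i).toAffineMap _ _

theorem mem_face_of_mem_segment {i : ℕ} {c d : Fin 3} {b : Bool} (hb : b = false → 0 < i)
    {z : ℝ × ℝ} (hz : z ∈ segment ℝ (T.point i c) (T.point (T.endLevel i d b) d)) :
    z ∈ T.face i ∨ b = false ∧ z = T.point (T.endLevel i d b) d := by
  rw [← T.chart_image_localEdge hb] at hz
  obtain ⟨x, hx, rfl⟩ := hz
  rcases mem_openFace_of_mem_localEdge hx with h | ⟨rfl, rfl⟩
  · exact Or.inl ⟨x, h, rfl⟩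
  · exact Or.inr ⟨rfl, T.chart_single (hb rfl) d⟩

/-- The edges of triangle `i` and those towards the corners of its face avoid the interiors of all
faces that are used later on. -/
theorem notMem_face_of_mem_segment {i j : ℕ} (hij : i < j) {c d : Fin 3} (hcd : c ≠ d) {b : Bool}
    (hb : b = false → 0 < i) {z : ℝ × ℝ}
    (hz : z ∈ segment ℝ (T.point i c) (T.point (T.endLevel i d b) d)) : z ∉ T.face j := by
  induction hn : i + j using Nat.strong_induction_on generalizing i j c d b with
  | _ n ih =>
    subst hn
    have hj₀ : 0 < j := by omega
    have hj := T.par_lt j hj₀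
    rcases lt_trichotomy (T.par j) i with h | h | h
    · rcases T.mem_face_of_mem_segment hb hz with h' | ⟨rfl, rfl⟩
      · exact Set.disjoint_left.1 (T.disjoint_face hij h) h'
      · have hlt : T.endLevel i d false < i := T.corner_lt (hb rfl) d
        exact ih _ (by omega) (hlt.trans hij) hcd.symm (b := true) (by simp)
          (left_mem_segment ℝ _ _) rfl
    · rintro ⟨y, hy, rfl⟩
      rw [T.chart_of_pos hj₀, h, ← T.chart_image_localEdge hb] at hz
      obtain ⟨x, hx, hxy⟩ := hz
      have hx' := localEdge_subset_baryPlane _ _ _ hx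
      have e := T.chart_injOn _ hx' (childMap_mem_baryPlane _ hy.1) hxy
      exact notMem_childRegion_of_mem_edgeRegion hcd hx' (localEdge_subset_edgeRegion hcd b hx)
        (T.kind j) (e ▸ childMap_mem_childRegion _ hy)
    · exact fun h' => ih _ (by omega) h hcd hb hz rfl (T.face_subset_face_par hj₀ h')

theorem point_notMem_face {i j : ℕ} (hij : i < j) (c : Fin 3) : T.point i c ∉ T.face j :=
  T.notMem_face_of_mem_segment hij (c := c) (d := c + 1) (by simp) (b := true) (by simp)
    (left_mem_segment ℝ _ _)

theorem point_injective {i j : ℕ} {c d : Fin 3} (h : T.point i c = T.point j d) :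
    i = j ∧ c = d := by
  rcases lt_trichotomy i j with hij | rfl | hij
  · exact absurd (h ▸ T.point_mem_face j d) (T.point_notMem_face hij c)
  · exact ⟨rfl, innerPoint_injective (T.chart_injOn i (innerPoint_mem_openFace c).1
      (innerPoint_mem_openFace d).1 h)⟩
  · exact absurd (h ▸ T.point_mem_face i c) (T.point_notMem_face hij d)

theorem eq_endpoint_of_point_mem_segment {i l : ℕ} {c d f : Fin 3} (hcd : c ≠ d) {b : Bool}
    (hb : b = false → 0 < i)
    (h : T.point l f ∈ segment ℝ (T.point i c) (T.point (T.endLevel i d b) d)) :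
    l = i ∧ f = c ∨ l = T.endLevel i d b ∧ f = d := by
  rcases lt_trichotomy l i with hl | rfl | hl
  · rcases T.mem_face_of_mem_segment hb h with h' | ⟨-, h'⟩
    · exact absurd h' (T.point_notMem_face hl f)
    · exact Or.inr (T.point_injective h')
  · rw [← T.chart_image_localEdge hb] at h
    obtain ⟨x, hx, hxy⟩ := h
    have e := T.chart_injOn _ (localEdge_subset_baryPlane _ _ _ hx) (innerPoint_mem_openFace f).1 hxy
    subst e
    rcases eq_or_eq_of_innerPoint_mem hcd (localEdge_subset_edgeRegion hcd b hx) with h | ⟨rfl, h⟩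
    · exact Or.inl ⟨rfl, h⟩
    · exact Or.inr ⟨rfl, h⟩
  · exact absurd (T.point_mem_face l f) (T.notMem_face_of_mem_segment hl hcd hb h)

/-- Distinct edges only meet in points that represent vertices. -/
theorem exists_eq_point_of_mem_segment {i j : ℕ} (hij : i ≤ j) {c d c' d' : Fin 3} (hcd : c ≠ d)
    (hcd' : c' ≠ d') {b b' : Bool} (hb : b = false → 0 < i) (hb' : b' = false → 0 < j)
    (hne : ¬ (i = j ∧ b = b' ∧ (c = c' ∧ d = d' ∨ b = true ∧ c = d' ∧ d = c'))) {z : ℝ × ℝ}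
    (hz : z ∈ segment ℝ (T.point i c) (T.point (T.endLevel i d b) d))
    (hz' : z ∈ segment ℝ (T.point j c') (T.point (T.endLevel j d' b') d')) :
    ∃ l f, z = T.point l f := by
  rcases hij.eq_or_lt with rfl | hlt
  · rw [← T.chart_image_localEdge hb] at hz
    rw [← T.chart_image_localEdge hb'] at hz'
    obtain ⟨x, hx, rfl⟩ := hz
    obtain ⟨y, hy, hxy⟩ := hz'
    have hx' := localEdge_subset_baryPlane _ _ _ hx
    have e := T.chart_injOn _ (localEdge_subset_baryPlane _ _ _ hy) hx' hxy
    subst e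
    rcases eq_of_mem_edgeRegion hcd hcd' hx' (localEdge_subset_edgeRegion hcd b hx)
      (localEdge_subset_edgeRegion hcd' b' hy) (fun h => hne ⟨rfl, h⟩) with
      ⟨f, rfl⟩ | ⟨rfl, f, rfl⟩
    · exact ⟨i, f, rfl⟩
    · exact ⟨_, f, T.chart_single (hb rfl) f⟩
  · rcases T.mem_face_of_mem_segment hb' hz' with h | ⟨-, h⟩
    · exact absurd h (T.notMem_face_of_mem_segment hlt hcd hb hz)
    · exact ⟨_, d', h⟩

/-- Every edge arises as an edge at the later one of its two triangles. -/
theorem exists_local_of_adj {x y : Fin m × Fin 3} (h : (T.graph m).Adj x y) :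
    ∃ (i : ℕ) (c d : Fin 3) (b : Bool), c ≠ d ∧ (b = false → 0 < i) ∧
      s(((x.1 : ℕ), x.2), ((y.1 : ℕ), y.2)) = s((i, c), (T.endLevel i d b, d)) := by
  obtain ⟨hc, h⟩ := h
  by_cases hxy : (x.1 : ℕ) = y.1
  · exact ⟨x.1, x.2, y.2, true, hc, by simp, by rw [← hxy]; rfl⟩
  · rcases h.resolve_left hxy with h | h
    · refine ⟨x.1, x.2, y.2, false, hc, fun _ => Nat.pos_of_ne_zero fun h₀ => ?_,
        by rw [← h]; rfl⟩
      rw [h₀, T.corner_zero] at h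
      omega
    · refine ⟨y.1, y.2, x.2, false, hc.symm, fun _ => Nat.pos_of_ne_zero fun h₀ => ?_,
        by rw [← h, Sym2.eq_swap]; rfl⟩
      rw [h₀, T.corner_zero] at h
      omega

theorem segment_eq_of_sym2_eq {x y x' y' : ℕ × Fin 3} (h : s(x, y) = s(x', y')) :
    segment ℝ (T.point x.1 x.2) (T.point y.1 y.2) =
      segment ℝ (T.point x'.1 x'.2) (T.point y'.1 y'.2) := by
  rcases Sym2.eq_iff.1 h with ⟨rfl, rfl⟩ | ⟨rfl, rfl⟩
  · rfl
  · exact segment_symm ℝ _ _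

theorem eq_or_eq_of_point_mem_segment {x y : Fin m × Fin 3} (h : (T.graph m).Adj x y)
    {l : ℕ} {f : Fin 3} (hl : T.point l f ∈ segment ℝ (T.point x.1 x.2) (T.point y.1 y.2)) :
    (l, f) = (↑x.1, x.2) ∨ (l, f) = (↑y.1, y.2) := by
  obtain ⟨i, c, d, b, hcd, hb, h⟩ := T.exists_local_of_adj h
  rw [T.segment_eq_of_sym2_eq h] at hl
  have := T.eq_endpoint_of_point_mem_segment hcd hb hl
  rw [← Sym2.mem_iff, h, Sym2.mem_iff]
  simpa only [Prod.mk.injEq] using this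

theorem exists_eq_point_of_mem_inter {x y x' y' : Fin m × Fin 3} (h : (T.graph m).Adj x y)
    (h' : (T.graph m).Adj x' y') (hne : s(x, y) ≠ s(x', y')) {z : ℝ × ℝ}
    (hz : z ∈ segment ℝ (T.point x.1 x.2) (T.point y.1 y.2))
    (hz' : z ∈ segment ℝ (T.point x'.1 x'.2) (T.point y'.1 y'.2)) : ∃ l f, z = T.point l f := by
  obtain ⟨i, c, d, b, hcd, hb, h⟩ := T.exists_local_of_adj h
  obtain ⟨i', c', d', b', hcd', hb', h'⟩ := T.exists_local_of_adj h'
  rw [T.segment_eq_of_sym2_eq h] at hz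
  rw [T.segment_eq_of_sym2_eq h'] at hz'
  have hdiff : ¬ (i = i' ∧ b = b' ∧ (c = c' ∧ d = d' ∨ b = true ∧ c = d' ∧ d = c')) := by
    intro hsame
    have hval : Function.Injective fun x : Fin m × Fin 3 => ((x.1 : ℕ), x.2) := fun x y e =>
      Prod.ext (Fin.ext (Prod.ext_iff.1 e).1) (Prod.ext_iff.1 e).2
    refine hne (Sym2.map.injective hval ?_)
    rw [Sym2.map_mk, Sym2.map_mk]
    refine h.trans (Eq.trans ?_ h'.symm)
    obtain ⟨rfl, rfl, ⟨rfl, rfl⟩ | ⟨rfl, rfl, rfl⟩⟩ := hsame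
    · rfl
    · exact Sym2.eq_swap
  rcases le_total i i' with hle | hle
  · exact T.exists_eq_point_of_mem_segment hle hcd hcd' hb hb' hdiff hz hz'
  · refine T.exists_eq_point_of_mem_segment hle hcd' hcd hb' hb (fun hsame => hdiff ?_) hz' hz
    obtain ⟨rfl, rfl, ⟨rfl, rfl⟩ | ⟨rfl, rfl, rfl⟩⟩ := hsame <;> simp

theorem point_val_injective :
    Function.Injective fun x : Fin m × Fin 3 => T.point x.1 x.2 := fun _ _ h =>
  Prod.ext (Fin.ext (T.point_injective h).1) (T.point_injective h).2

/-- The straight-line drawing of the graph of iterated octahedron insertions. -/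
noncomputable def planeEmbedding (m : ℕ) : PlaneEmbedding (T.graph m) where
  vtx x := T.point x.1 x.2
  vtx_inj := T.point_val_injective
  arc x y _ := segment ℝ (T.point x.1 x.2) (T.point y.1 y.2)
  arc_symm _ _ _ := segment_symm ℝ _ _
  arc_path _ _ h := ⟨Path.segment _ _,
    Path.segment_injective_of_ne fun e => h.ne (T.point_val_injective e), Path.range_segment _ _⟩
  arc_vtx x y h w hw := by
    simpa only [Prod.ext_iff, Fin.ext_iff (n := m)] using T.eq_or_eq_of_point_mem_segment h hw
  arc_inter x y x' y' h h' hne z hz := by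
    obtain ⟨l, f, rfl⟩ := T.exists_eq_point_of_mem_inter h h' hne hz.1 hz.2
    have hpoint {w : Fin m × Fin 3} (e : (l, f) = (↑w.1, w.2)) :
        T.point l f = T.point w.1 w.2 :=
      congrArg (fun v : ℕ × Fin 3 => T.point v.1 v.2) e
    exact ⟨(T.eq_or_eq_of_point_mem_segment h hz.1).imp hpoint hpoint,
      (T.eq_or_eq_of_point_mem_segment h' hz.2).imp hpoint hpoint⟩

/-- The graph of iterated octahedron insertions is a plane triangulation. -/
theorem isPlaneTriangulation_graph (m : ℕ) : IsPlaneTriangulation (T.graph m) :=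
  ⟨⟨T.planeEmbedding m⟩, fun _ _ huv hn => T.not_isPlanar_sup_edge huv hn⟩

end InsertionTree

/-! ### The extremal triangulations -/

/-- The parent of triangle `i` in the extremal triangulations: the first eight triangles are nested;
in each later block of eight triangles, the second one has three children, namely the third, the
fifth and the seventh one. -/
def blockPar (i : ℕ) : ℕ :=
  if 8 ≤ i ∧ (i % 8 = 4 ∨ i % 8 = 6) then i - i % 8 + 1 else i - 1

/-- The kind of triangle `i` in the extremal triangulations. -/
def blockKind (i : ℕ) : Option (Fin 3) :=
  if 8 ≤ i ∧ i % 8 = 2 then some 0 else if 8 ≤ i ∧ i % 8 = 4 then some 1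
  else if 8 ≤ i ∧ i % 8 = 6 then some 2 else none

/-- The corners of the faces in the extremal triangulations. -/
def blockCorner (i : ℕ) (c : Fin 3) : ℕ :=
  if 8 ≤ i ∧ i % 8 = 2 * (c + 1) then i - i % 8 else blockPar i

theorem blockPar_spec (i : ℕ) :
    (8 ≤ i ∧ (i % 8 = 4 ∨ i % 8 = 6)) ∧ blockPar i = i - i % 8 + 1 ∨
      ¬ (8 ≤ i ∧ (i % 8 = 4 ∨ i % 8 = 6)) ∧ blockPar i = i - 1 := by
  unfold blockPar
  split_ifs with h <;> simp [h]

theorem blockKind_eq_some_iff (i : ℕ) (c : Fin 3) :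
    blockKind i = some c ↔ 8 ≤ i ∧ i % 8 = 2 * ((c : ℕ) + 1) := by
  unfold blockKind
  split_ifs <;> fin_cases c <;> simp <;> omega

theorem blockCorner_spec (i : ℕ) (c : Fin 3) :
    (8 ≤ i ∧ i % 8 = 2 * ((c : ℕ) + 1)) ∧ blockCorner i c = i - i % 8 ∨
      ¬ (8 ≤ i ∧ i % 8 = 2 * ((c : ℕ) + 1)) ∧
        ((8 ≤ i ∧ (i % 8 = 4 ∨ i % 8 = 6)) ∧ blockCorner i c = i - i % 8 + 1 ∨
          ¬ (8 ≤ i ∧ (i % 8 = 4 ∨ i % 8 = 6)) ∧ blockCorner i c = i - 1) := by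
  have := blockPar_spec i
  unfold blockCorner
  split_ifs with h
  · exact Or.inl ⟨h, rfl⟩
  · exact Or.inr ⟨h, this⟩

/-- The insertion tree of the extremal triangulations. -/
def blockTree : InsertionTree where
  par := blockPar
  kind := blockKind
  corner := blockCorner
  par_lt i hi := by have := blockPar_spec i; omega
  corner_zero c := by have := blockCorner_spec 0 c; omega
  corner_eq i c hi := by
    split_ifs with h <;> rw [blockKind_eq_some_iff] at h
    · have h₁ := blockPar_spec i
      have h₂ : blockPar i = i - i % 8 + 1 := by omega
      have h₃ : blockCorner (i - i % 8 + 1) c = i - i % 8 := by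
        have := blockCorner_spec (i - i % 8 + 1) c
        have hn : (i - i % 8) % 8 = 0 := by omega
        generalize i - i % 8 = n at this hn ⊢
        omega
      rw [h₂, h₃, blockCorner, if_pos h]
    · rw [blockCorner, if_neg h]
  par_pos i c hi h := by
    rw [blockKind_eq_some_iff] at h
    have := blockPar_spec i
    omega
  kind_inj i j hi hj hp hk := by
    have hk' (c : Fin 3) := (blockKind_eq_some_iff i c).symm.trans
      ((by rw [hk] : blockKind i = some c ↔ blockKind j = some c).trans (blockKind_eq_some_iff j c))
    have h₄ : 8 ≤ i ∧ i % 8 = 4 ↔ 8 ≤ j ∧ j % 8 = 4 := hk' 1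
    have h₆ : 8 ≤ i ∧ i % 8 = 6 ↔ 8 ≤ j ∧ j % 8 = 6 := hk' 2
    by_cases hi₄ : 8 ≤ i ∧ i % 8 = 4
    · have hj₄ := h₄.1 hi₄
      rw [blockPar, blockPar, if_pos (by omega), if_pos (by omega)] at hp
      clear h₄ h₆ hk'
      omega
    by_cases hi₆ : 8 ≤ i ∧ i % 8 = 6
    · have hj₆ := h₆.1 hi₆
      rw [blockPar, blockPar, if_pos (by omega), if_pos (by omega)] at hp
      clear h₄ h₆ hk'
      omega
    have hj₄ := mt h₄.2 hi₄
    have hj₆ := mt h₆.2 hi₆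
    clear h₄ h₆ hk'
    rw [blockPar, blockPar, if_neg (by omega), if_neg (by omega)] at hp
    omega

theorem blockTree_adj {m : ℕ} {x y : Fin m × Fin 3} : (blockTree.graph m).Adj x y ↔ x.2 ≠ y.2 ∧
    ((x.1 : ℕ) = y.1 ∨ blockCorner x.1 y.2 = y.1 ∨ blockCorner y.1 x.2 = x.1) := Iff.rfl

/-! ### A small connected dominating set -/

/-- The color `c` is chosen in triangle `i`. -/
def IsChosen (i : ℕ) (c : Fin 3) : Prop :=
  if 8 ≤ i ∧ i % 8 = 1 then (c : ℕ) ≠ 0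
  else if 8 ≤ i ∧ i % 8 = 2 then (c : ℕ) = 1
  else if 8 ≤ i ∧ i % 8 = 3 then (c : ℕ) = 0
  else (c : ℕ) = i % 2

instance (i : ℕ) (c : Fin 3) : Decidable (IsChosen i c) := by
  unfold IsChosen
  infer_instance

theorem isChosen_iff (i : ℕ) (c : Fin 3) : IsChosen i c ↔
    8 ≤ i ∧ i % 8 = 1 ∧ (c : ℕ) ≠ 0 ∨ 8 ≤ i ∧ i % 8 = 2 ∧ (c : ℕ) = 1 ∨
      8 ≤ i ∧ i % 8 = 3 ∧ (c : ℕ) = 0 ∨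
      ¬ (8 ≤ i ∧ (i % 8 = 1 ∨ i % 8 = 2 ∨ i % 8 = 3)) ∧ (c : ℕ) = i % 2 := by
  unfold IsChosen
  split_ifs <;> omega

theorem exists_isChosen (i : ℕ) : ∃ c, IsChosen i c := by
  simp only [isChosen_iff]
  by_cases h₁ : 8 ≤ i ∧ i % 8 = 1
  · exact ⟨1, by simp; omega⟩
  · by_cases h₂ : 8 ≤ i ∧ i % 8 = 2
    · exact ⟨1, by simp; omega⟩
    · by_cases h₃ : 8 ≤ i ∧ i % 8 = 3
      · exact ⟨0, by simp; omega⟩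
      · exact ⟨⟨i % 2, by omega⟩, by simp; omega⟩

theorem exists_isChosen_blockCorner {i : ℕ} (hi : 0 < i) {c : Fin 3} (hc : IsChosen i c) :
    ∃ d, c ≠ d ∧ IsChosen (blockCorner i d) d := by
  obtain ⟨d, hd⟩ : ∃ d : Fin 3, 8 ≤ i ∧ i % 8 = 4 ∧ (d : ℕ) = 2 ∨
      (8 ≤ i ∧ (i % 8 = 3 ∨ i % 8 = 6)) ∧ (d : ℕ) = 1 ∨
      (8 ≤ i ∧ (i % 8 = 1 ∨ i % 8 = 2)) ∧ (d : ℕ) = 0 ∨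
      ¬ (8 ≤ i ∧ (i % 8 = 1 ∨ i % 8 = 2 ∨ i % 8 = 3 ∨ i % 8 = 4 ∨ i % 8 = 6)) ∧
        (d : ℕ) = (i + 1) % 2 := by
    by_cases h₁ : 8 ≤ i ∧ i % 8 = 4
    · exact ⟨2, by simp; omega⟩
    · by_cases h₂ : 8 ≤ i ∧ (i % 8 = 3 ∨ i % 8 = 6)
      · exact ⟨1, by simp; omega⟩
      · by_cases h₃ : 8 ≤ i ∧ (i % 8 = 1 ∨ i % 8 = 2)
        · exact ⟨0, by simp; omega⟩
        · exact ⟨⟨(i + 1) % 2, by omega⟩, by simp; omega⟩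
  refine ⟨d, ?_, ?_⟩
  · rw [isChosen_iff] at hc
    rw [Ne, Fin.ext_iff]
    omega
  · have hd' := blockCorner_spec i d
    rw [isChosen_iff]
    generalize blockCorner i d = j at *
    rcases hd with hd | ⟨⟨hi₈, hr | hr⟩, hd⟩ | ⟨⟨hi₈, hr | hr⟩, hd⟩ | hd
    · obtain rfl : j = i - i % 8 + 1 := by omega
      omega
    · obtain rfl : j = i - 1 := by omega
      omega
    · obtain rfl : j = i - i % 8 + 1 := by omega
      omega
    · obtain rfl : j = i - 1 := by omega
      omega
    · obtain rfl : j = i - i % 8 := by omega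
      omega
    · obtain rfl : j = i - 1 := by omega
      omega

/-- The set of chosen vertices. -/
def chosenSet (m : ℕ) : Finset (Fin m × Fin 3) := {x | IsChosen x.1 x.2}

theorem mem_chosenSet {m : ℕ} {x : Fin m × Fin 3} : x ∈ chosenSet m ↔ IsChosen x.1 x.2 := by
  simp [chosenSet]

theorem reachable_chosenSet {m : ℕ} (hm : 0 < m) (x : (chosenSet m : Set (Fin m × Fin 3))) :
    ((blockTree.graph m).induce (chosenSet m : Set (Fin m × Fin 3))).Reachable x
      ⟨(⟨0, hm⟩, 0), mem_chosenSet.2 (by simp [isChosen_iff])⟩ := by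
  obtain ⟨⟨i, c⟩, hx⟩ := x
  induction hn : (i : ℕ) using Nat.strong_induction_on generalizing i c with
  | _ n ih =>
    subst hn
    have hc : IsChosen i c := mem_chosenSet.1 hx
    rcases Nat.eq_zero_or_pos (i : ℕ) with hi | hi
    · have hi' : i = ⟨0, hm⟩ := Fin.ext hi
      have hc' : c = 0 := by
        rw [isChosen_iff] at hc
        apply Fin.ext
        rw [Fin.val_zero]
        omega
      subst hi' hc'
      rfl
    · obtain ⟨d, hcd, hd⟩ := exists_isChosen_blockCorner hi hc
      have hmem : blockTree.cornerVertex i d ∈ (chosenSet m : Set (Fin m × Fin 3)) :=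
        mem_chosenSet.2 hd
      have hadj : ((blockTree.graph m).induce (chosenSet m : Set (Fin m × Fin 3))).Adj
          ⟨(i, c), hx⟩ ⟨blockTree.cornerVertex i d, hmem⟩ := blockTree.adj_cornerVertex i hcd
      exact hadj.reachable.trans (ih _ (blockTree.corner_lt hi d) _ _ hmem rfl)

theorem isConnDomSet_chosenSet {m : ℕ} (hm : 0 < m) :
    IsConnDomSet (blockTree.graph m) (chosenSet m : Set (Fin m × Fin 3)) := by
  constructor
  · rintro ⟨i, c⟩
    obtain ⟨d, hd⟩ := exists_isChosen i
    have hmem : (i, d) ∈ (chosenSet m : Set (Fin m × Fin 3)) := mem_chosenSet.2 hd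
    by_cases hcd : d = c
    · exact Or.inl (hcd ▸ hmem)
    · exact Or.inr ⟨_, hmem, blockTree.adj_level i hcd⟩
  · have : Nonempty (chosenSet m : Set (Fin m × Fin 3)) :=
      ⟨(⟨0, hm⟩, 0), mem_chosenSet.2 (by simp [isChosen_iff])⟩
    exact ⟨fun x y => (reachable_chosenSet hm x).trans (reachable_chosenSet hm y).symm⟩

theorem card_isChosen (i : ℕ) : (∑ c : Fin 3, if IsChosen i c then 1 else 0) =
    if 8 ≤ i ∧ i % 8 = 1 then 2 else 1 := by
  rw [Fin.sum_univ_three]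
  by_cases h₁ : 8 ≤ i ∧ i % 8 = 1
  · simp only [IsChosen, if_pos h₁]
    rfl
  by_cases h₂ : 8 ≤ i ∧ i % 8 = 2
  · simp only [IsChosen, if_neg h₁, if_pos h₂]
    rfl
  by_cases h₃ : 8 ≤ i ∧ i % 8 = 3
  · simp only [IsChosen, if_neg h₁, if_neg h₂, if_pos h₃]
    rfl
  simp only [IsChosen, if_neg h₁, if_neg h₂, if_neg h₃]
  rcases Nat.mod_two_eq_zero_or_one i with h | h <;> rw [h] <;> rfl

theorem card_chosenSet {k : ℕ} (hk : 0 < k) : (chosenSet (8 * k)).card = 9 * k - 1 := by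
  have hsum : (chosenSet (8 * k)).card =
      ∑ i ∈ Finset.range (8 * k), if 8 ≤ i ∧ i % 8 = 1 then 2 else 1 := by
    rw [chosenSet, Finset.card_filter, Fintype.sum_prod_type,
      ← Fin.sum_univ_eq_sum_range (fun i => if 8 ≤ i ∧ i % 8 = 1 then 2 else 1)]
    exact Finset.sum_congr rfl fun i _ => card_isChosen i
  rw [hsum]
  clear hsum
  induction k, hk using Nat.le_induction with
  | base => decide
  | succ k hk ih =>
    have hblock : ∑ j ∈ Finset.range 8, (if 8 ≤ 8 * k + j ∧ (8 * k + j) % 8 = 1 then 2 else 1) =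
        ∑ j ∈ Finset.range 8, if j = 1 then 2 else 1 :=
      Finset.sum_congr rfl fun j hj => if_congr (by have := Finset.mem_range.1 hj; omega) rfl rfl
    rw [Nat.mul_succ, Finset.sum_range_add, ih, hblock, show
      (∑ j ∈ Finset.range 8, if j = 1 then 2 else 1) = 9 from rfl]
    omega

/-! ### The lower bound -/

/-- If a connected set meets both a set of vertices and its complement, then it contains an edge
between them. -/
theorem exists_adj_of_connected_induce {V : Type*} {G : SimpleGraph V} {X : Set V}
    (h : (G.induce X).Connected) (P : V → Prop) {a b : V} (ha : a ∈ X) (hb : b ∈ X) (hPa : P a)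
    (hPb : ¬ P b) : ∃ x ∈ X, ∃ y ∈ X, P x ∧ ¬ P y ∧ G.Adj x y := by
  obtain ⟨w⟩ := h.preconnected ⟨a, ha⟩ ⟨b, hb⟩
  obtain ⟨d, -, hd₁, hd₂⟩ := w.exists_boundary_dart {x | P x} hPa hPb
  exact ⟨d.fst, d.fst.2, d.snd, d.snd.2, hd₁, hd₂, d.adj⟩

/-- Adjacency in the extremal triangulations, in terms of levels and colors. -/
def BlockAdj (i : ℕ) (c : Fin 3) (j : ℕ) (d : Fin 3) : Prop :=
  c ≠ d ∧ (i = j ∨ blockCorner i d = j ∨ blockCorner j c = i)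

/-- The colors chosen on every level by a connected dominating set of an extremal triangulation
with `m` levels. -/
structure IsConnDomFamily (m : ℕ) (Y : ℕ → Finset (Fin 3)) : Prop where
  lt : ∀ {i c}, c ∈ Y i → i < m
  dom : ∀ {i} (c), i < m → c ∈ Y i ∨ ∃ j d, d ∈ Y j ∧ BlockAdj i c j d
  cut : ∀ (P : ℕ → Fin 3 → Prop) {i c j d}, c ∈ Y i → d ∈ Y j → P i c → ¬ P j d →
    ∃ i' c' j' d', c' ∈ Y i' ∧ d' ∈ Y j' ∧ P i' c' ∧ ¬ P j' d' ∧ BlockAdj i' c' j' d'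

/-- The colors of the elements of `X` on level `i`. -/
def levelColors {m : ℕ} (X : Finset (Fin m × Fin 3)) (i : ℕ) : Finset (Fin 3) :=
  {c | ∃ h : i < m, (⟨i, h⟩, c) ∈ X}

theorem mem_levelColors {m : ℕ} {X : Finset (Fin m × Fin 3)} {i : ℕ} {c : Fin 3} :
    c ∈ levelColors X i ↔ ∃ h : i < m, (⟨i, h⟩, c) ∈ X := by
  simp [levelColors]

theorem sum_card_levelColors {m : ℕ} (X : Finset (Fin m × Fin 3)) :
    ∑ i ∈ Finset.range m, (levelColors X i).card = X.card := by
  have hX : X.card = ∑ x, if x ∈ X then 1 else 0 := by simp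
  rw [hX, Fintype.sum_prod_type, ← Fin.sum_univ_eq_sum_range (fun i => (levelColors X i).card)]
  refine Finset.sum_congr rfl fun i _ => ?_
  rw [levelColors, Finset.card_filter]
  simp

theorem isConnDomFamily_levelColors {m : ℕ} {X : Finset (Fin m × Fin 3)}
    (h : IsConnDomSet (blockTree.graph m) (X : Set (Fin m × Fin 3))) :
    IsConnDomFamily m (levelColors X) where
  lt hc := (mem_levelColors.1 hc).1
  dom {i} c hi := by
    rcases h.1 (⟨i, hi⟩, c) with hX | ⟨⟨j, d⟩, hX, hadj⟩
    · exact Or.inl (mem_levelColors.2 ⟨hi, hX⟩)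
    · exact Or.inr ⟨j, d, mem_levelColors.2 ⟨j.2, hX⟩, blockTree_adj.1 hadj.symm⟩
  cut P i c j d hc hd hPc hPd := by
    obtain ⟨hi, hc⟩ := mem_levelColors.1 hc
    obtain ⟨hj, hd⟩ := mem_levelColors.1 hd
    obtain ⟨x, hx, y, hy, hPx, hPy, hxy⟩ :=
      exists_adj_of_connected_induce h.2 (fun x => P x.1 x.2) hc hd hPc hPd
    exact ⟨x.1, x.2, y.1, y.2, mem_levelColors.2 ⟨x.1.2, hx⟩, mem_levelColors.2 ⟨y.1.2, hy⟩,
      hPx, hPy, blockTree_adj.1 hxy⟩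

theorem blockCorner_le (i : ℕ) (c : Fin 3) : blockCorner i c ≤ i := blockTree.corner_le i c

namespace IsConnDomFamily

variable {m : ℕ} {Y : ℕ → Finset (Fin 3)}

/-- If all neighbors of level `i` lie on the levels `i` and `j`, then these two levels together
contain two elements of a connected dominating set that is not contained in them. -/
theorem two_le_card_add_card (h : IsConnDomFamily m Y) {i j i' : ℕ} {c' : Fin 3} (hi : i < m)
    (hij : ∀ c l d, l < m → BlockAdj i c l d → l = i ∨ l = j) (hc' : c' ∈ Y i') (hi' : i' ≠ i) :
    2 ≤ (Y i).card + (Y j).card := by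
  rcases (Y i).eq_empty_or_nonempty with he | ⟨c, hc⟩
  · have key (c : Fin 3) : ∃ d ∈ Y j, c ≠ d := by
      rcases h.dom c hi with hc | ⟨l, d, hd, hadj⟩
      · simp [he] at hc
      · rcases hij c l d (h.lt hd) hadj with rfl | rfl
        · simp [he] at hd
        · exact ⟨d, hd, hadj.1⟩
    obtain ⟨d, hd, -⟩ := key 0
    obtain ⟨e, he, hde⟩ := key d
    exact (Finset.one_lt_card.2 ⟨d, hd, e, he, hde⟩).trans_le (Nat.le_add_left _ _)
  · obtain ⟨l, c₁, l', c₂, -, h₂, rfl, hl', hadj⟩ := h.cut (fun l _ => l = i) hc hc' rfl hi'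
    obtain rfl : l' = j := (hij c₁ l' c₂ (h.lt h₂) hadj).resolve_left hl'
    have := Finset.card_pos.2 ⟨c, hc⟩
    have := Finset.card_pos.2 ⟨c₂, h₂⟩
    omega

/-- A level separating the earlier levels from the later ones meets a connected dominating set
with elements on both sides. -/
theorem card_pos_of_separates (h : IsConnDomFamily m Y) {i j j' : ℕ} {c c' : Fin 3}
    (hi : ∀ l c, i < l → i ≤ blockCorner l c) (hc : c ∈ Y j) (hj : j < i) (hc' : c' ∈ Y j')
    (hj' : i ≤ j') : 0 < (Y i).card := by
  obtain ⟨l, c₁, l', c₂, -, h₂, hl, hl', -, hadj⟩ :=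
    h.cut (fun l _ => l < i) hc hc' hj (by omega)
  have h₁ := blockCorner_le l c₂
  have h₃ := hi l' c₁
  obtain rfl : l' = i := by omega
  exact Finset.card_pos.2 ⟨c₂, h₂⟩

end IsConnDomFamily

/-- The levels of the branch with color `c` of the block starting at level `n`. -/
def InArm (n : ℕ) (c : Fin 3) (j : ℕ) : Prop :=
  n + 2 * (c : ℕ) + 2 ≤ j ∧ (j ≤ n + 2 * (c : ℕ) + 3 ∨ (c : ℕ) = 2)

theorem BlockAdj.of_inArm {q j l : ℕ} (hq : 0 < q) {c e d : Fin 3} (hj : InArm (8 * q) c j)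
    (hl : ¬ InArm (8 * q) c l) (hadj : BlockAdj j e l d) :
    l = 8 * q ∧ d = c ∨ l = 8 * q + 1 ∧ d ≠ c := by
  rw [Ne, Fin.ext_iff]
  unfold InArm at hj hl
  have hc := c.2
  have hd := d.2
  rcases hadj.2 with hadj | hadj | hadj
  · omega
  · have h₁ := blockCorner_spec j d
    rw [hadj] at h₁
    clear hadj
    rcases h₁ with h₁ | ⟨h₁, h₂ | h₂⟩
    · omega
    · omega
    · omega
  · have h₁ := blockCorner_spec l e
    rw [hadj] at h₁
    clear hadj
    rcases h₁ with h₁ | ⟨h₁, h₂ | h₂⟩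
    · omega
    · omega
    · omega

namespace IsConnDomFamily

variable {m : ℕ} {Y : ℕ → Finset (Fin 3)}

theorem mem_or_exists_ne (h : IsConnDomFamily m Y) {q j : ℕ} (hq : 0 < q) (hm : 8 * q + 7 < m)
    {d : Fin 3} (hd : d ∈ Y j) (hj : j < 8 * q) (c : Fin 3) :
    c ∈ Y (8 * q) ∨ ∃ e ∈ Y (8 * q + 1), e ≠ c := by
  have hcut {l l' : ℕ} {a b : Fin 3} (hb : b ∈ Y l') (hl : InArm (8 * q) c l)
      (hl' : ¬ InArm (8 * q) c l') (hadj : BlockAdj l a l' b) :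
      c ∈ Y (8 * q) ∨ ∃ e ∈ Y (8 * q + 1), e ≠ c := by
    rcases hadj.of_inArm hq hl hl' with ⟨rfl, rfl⟩ | ⟨rfl, hbc⟩
    · exact Or.inl hb
    · exact Or.inr ⟨b, hb, hbc⟩
  have hc := c.2
  have harm : InArm (8 * q) c (8 * q + 2 * (c : ℕ) + 2) := by
    unfold InArm
    omega
  have hfar {l : ℕ} {a : Fin 3} (ha : a ∈ Y l) (hl : InArm (8 * q) c l) :
      c ∈ Y (8 * q) ∨ ∃ e ∈ Y (8 * q + 1), e ≠ c := by
    have hj' : ¬ InArm (8 * q) c j := by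
      unfold InArm
      omega
    obtain ⟨l, a, l', b, -, hb, hl, hl', hadj⟩ :=
      h.cut (fun l _ => InArm (8 * q) c l) ha hd hl hj'
    exact hcut hb hl hl' hadj
  rcases h.dom 0 (by omega : 8 * q + 2 * (c : ℕ) + 2 < m) with ha | ⟨l, a, ha, hadj⟩
  · exact hfar ha harm
  · by_cases hl : InArm (8 * q) c l
    · exact hfar ha hl
    · exact hcut ha harm hl hadj

theorem three_le_card_add_card (h : IsConnDomFamily m Y) {q j j' : ℕ} (hq : 0 < q)
    (hm : 8 * q + 7 < m) {d d' : Fin 3} (hd : d ∈ Y j) (hj : j < 8 * q) (hd' : d' ∈ Y j')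
    (hj' : 8 * q ≤ j') : 3 ≤ (Y (8 * q)).card + (Y (8 * q + 1)).card := by
  have hcorner (l : ℕ) (c : Fin 3) (hl : 8 * q < l) : 8 * q ≤ blockCorner l c := by
    have := blockCorner_spec l c
    omega
  have hpos := h.card_pos_of_separates hcorner hd hj hd' hj'
  have hhit := h.mem_or_exists_ne hq hm hd hj
  by_contra! hlt
  rcases (Y (8 * q + 1)).eq_empty_or_nonempty with he | hne
  · have hall : Y (8 * q) = Finset.univ := Finset.eq_univ_of_forall fun c => by
      simpa [he] using hhit c
    simp [hall] at hlt
  · have := Finset.card_pos.2 hne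
    obtain ⟨c, hc⟩ := Finset.card_eq_one.1 (by omega : (Y (8 * q)).card = 1)
    obtain ⟨e, he⟩ := Finset.card_eq_one.1 (by omega : (Y (8 * q + 1)).card = 1)
    obtain rfl : e = c := by simpa [hc, he] using hhit e
    obtain ⟨l, a, l', b, ha, hb, hP, hP', hadj⟩ := h.cut
      (fun l a => l < 8 * q ∨ l = 8 * q ∧ a = e ∨ InArm (8 * q) e l) hd
      (he ▸ Finset.mem_singleton_self e) (Or.inl hj) (by unfold InArm; omega)
    obtain ⟨hlb, hb', harm⟩ : 8 * q ≤ l' ∧ ¬ (l' = 8 * q ∧ b = e) ∧ ¬ InArm (8 * q) e l' := by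
      simpa using hP'
    have hne : l' ≠ 8 * q := by
      rintro rfl
      exact hb' ⟨rfl, by simpa [hc] using hb⟩
    rcases hP with hl | ⟨rfl, rfl⟩ | hl
    · have h₁ := hcorner l' a
      have h₂ := blockCorner_le l b
      have := hadj.2
      omega
    · have h₁ := blockCorner_spec l' a
      have h₂ := blockCorner_le (8 * q) b
      have h₃ : blockCorner l' a = 8 * q := by
        have := hadj.2
        omega
      have h₄ : l' = 8 * q + 1 := by
        unfold InArm at harm
        rw [h₃] at h₁
        omega
      subst h₄
      rw [he, Finset.mem_singleton] at hb
      exact hadj.1 hb.symm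
    · rcases hadj.of_inArm hq hl harm with ⟨rfl, -⟩ | ⟨rfl, hbe⟩
      · exact hne rfl
      · exact hbe (by simpa [he] using hb)

theorem le_sum_card {k : ℕ} (hk : 2 ≤ k) (h : IsConnDomFamily (8 * k) Y) {q : ℕ} (hq : 0 < q)
    (hqk : q ≤ k) : 9 * q - 1 ≤ ∑ i ∈ Finset.range (8 * q), (Y i).card := by
  obtain ⟨i₀, c₀, h₀, hi₀⟩ : ∃ i c, c ∈ Y i ∧ i ≤ 1 := by
    rcases h.dom 0 (by omega : 0 < 8 * k) with hc | ⟨j, d, hd, -, hadj⟩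
    · exact ⟨0, 0, hc, zero_le_one⟩
    · refine ⟨j, d, hd, ?_⟩
      have h₁ := blockCorner_le 0 d
      have h₂ := blockCorner_spec j 0
      omega
  obtain ⟨i₁, c₁, h₁, hi₁⟩ : ∃ i c, c ∈ Y i ∧ 8 * k - 2 ≤ i := by
    rcases h.dom 0 (by omega : 8 * k - 1 < 8 * k) with hc | ⟨j, d, hd, -, hadj⟩
    · exact ⟨_, 0, hc, by omega⟩
    · refine ⟨j, d, hd, ?_⟩
      have h₁ := blockCorner_le j 0
      have h₂ := blockCorner_spec (8 * k - 1) d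
      omega
  have hsep {i : ℕ} (hi : 2 ≤ i) (hik : i ≤ 8 * k - 2)
      (hcorner : ∀ l c, i < l → i ≤ blockCorner l c) : 0 < (Y i).card :=
    h.card_pos_of_separates hcorner h₀ (by omega) h₁ (by omega)
  induction q, hq using Nat.le_induction with
  | base =>
    have h01 : 2 ≤ (Y 0).card + (Y 1).card := by
      refine h.two_le_card_add_card (by omega) (fun c l d _ hadj => ?_) h₁ (by omega)
      have h₁ := blockCorner_le 0 d
      have h₂ := blockCorner_spec l c
      have := hadj.2
      omega
    have hlow {i : ℕ} (hi : 2 ≤ i) (hi' : i < 8) : 0 < (Y i).card := by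
      refine hsep hi (by omega) fun l c hl => ?_
      have := blockCorner_spec l c
      omega
    have h2 := hlow (i := 2) (by omega) (by omega)
    have h3 := hlow (i := 3) (by omega) (by omega)
    have h4 := hlow (i := 4) (by omega) (by omega)
    have h5 := hlow (i := 5) (by omega) (by omega)
    have h6 := hlow (i := 6) (by omega) (by omega)
    have h7 := hlow (i := 7) (by omega) (by omega)
    simp only [Nat.zero_add, Nat.mul_one, Finset.sum_range_succ, Finset.sum_range_zero]
    omega
  | succ q hq ih =>
    have ih := ih (by omega)
    have h01 := h.three_le_card_add_card hq (by omega) h₀ (by omega) h₁ (by omega)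
    have harm {r : ℕ} (hr : r = 2 ∨ r = 4) :
        2 ≤ (Y (8 * q + r + 1)).card + (Y (8 * q + r)).card := by
      refine h.two_le_card_add_card (by omega) (fun c l d _ hadj => ?_) h₀ (by omega)
      rcases hadj.2 with hadj | hadj | hadj
      · omega
      · have := blockCorner_spec (8 * q + r + 1) d
        omega
      · have := blockCorner_spec l c
        omega
    have h23 : 2 ≤ (Y (8 * q + 3)).card + (Y (8 * q + 2)).card := harm (by omega)
    have h45 : 2 ≤ (Y (8 * q + 5)).card + (Y (8 * q + 4)).card := harm (by omega)
    have h67 : 2 ≤ (Y (8 * q + 7)).card + (Y (8 * q + 6)).card := by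
      rcases (by omega : q + 1 = k ∨ q + 1 < k) with hqk' | hqk'
      · refine h.two_le_card_add_card (by omega) (fun c l d hl hadj => ?_) h₀ (by omega)
        rcases hadj.2 with hadj | hadj | hadj
        · omega
        · have := blockCorner_spec (8 * q + 7) d
          omega
        · have := blockCorner_spec l c
          omega
      · have hlow {r : ℕ} (hr : r = 6 ∨ r = 7) : 0 < (Y (8 * q + r)).card := by
          refine hsep (by omega) (by omega) fun l c hl => ?_
          have := blockCorner_spec l c
          omega
        have h6 := hlow (r := 6) (by omega)
        have h7 := hlow (r := 7) (by omega)
        omega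
    rw [Nat.mul_succ 8, Finset.sum_range_add]
    simp only [Finset.sum_range_succ, Finset.sum_range_zero, Nat.add_zero]
    omega

end IsConnDomFamily

theorem connDomNum_blockTree {k : ℕ} (hk : 2 ≤ k) :
    connDomNum (blockTree.graph (8 * k)) = 9 * k - 1 := by
  have hmem : 9 * k - 1 ∈ {n | ∃ S : Finset (Fin (8 * k) × Fin 3),
      IsConnDomSet (blockTree.graph (8 * k)) ↑S ∧ S.card = n} :=
    ⟨_, isConnDomSet_chosenSet (by omega), card_chosenSet (by omega)⟩
  refine le_antisymm (Nat.sInf_le hmem) (le_csInf ⟨_, hmem⟩ ?_)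
  rintro _ ⟨X, hX, rfl⟩
  rw [← sum_card_levelColors X]
  exact (isConnDomFamily_levelColors hX).le_sum_card hk (by omega) le_rfl

/-- For every `k ≥ 2` there is an Eulerian plane triangulation of
order `n = 24k` whose connected domination number is exactly `3n/8 − 1 = 9k − 1`. -/
theorem stmt16 (k : ℕ) (hk : 2 ≤ k) :
    ∃ (V : Type) (inst : Fintype V) (G : SimpleGraph V) (_ : PlaneEmbedding G),
      IsPlaneTriangulation G ∧ IsEulerian G ∧
      @Fintype.card V inst = 24 * k ∧
      @connDomNum V inst G = 9 * k - 1 := by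
  refine ⟨Fin (8 * k) × Fin 3, inferInstance, blockTree.graph (8 * k),
    blockTree.planeEmbedding (8 * k), blockTree.isPlaneTriangulation_graph (8 * k),
    blockTree.isEulerian_graph, ?_, connDomNum_blockTree hk⟩
  rw [Fintype.card_prod, Fintype.card_fin, Fintype.card_fin]
  omega
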